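/- arXiv:2106.00004 — 4 statements merged into one kernel-verified Lean document; each statement's English description precedes it below -/
import Mathlib

section
/- Let f(x) = x^n − m ∈ ℤ[x] be a monic irreducible polynomial with n ≥ 2, write n = 2^r · t with t odd, and let K = ℚ(α) for a complex root α of f. If m is odd, r = 2, and ν_2(m − 1) ≥ 4, then 2 divides the index (𝓞_K : ℤ[θ]) for every θ ∈ 𝓞_K generating K over ℚ; in particular K is not monogenic. -/
open Polynomial

open scoped QuadraticAlgebra

theorem padicInt_parity (x : ℤ_[2]) : ∃ c, x = 2 * c ∨ x = 2 * c + 1 := by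
  have key : ∀ y : ℤ_[2], PadicInt.toZMod y = 0 → ∃ c, y = 2 * c := by
    intro y hy
    have : y ∈ RingHom.ker (PadicInt.toZMod : ℤ_[2] →+* ZMod 2) := hy
    rw [PadicInt.ker_toZMod, PadicInt.maximalIdeal_eq_span_p, Ideal.mem_span_singleton] at this
    obtain ⟨c, hc⟩ := this
    exact ⟨c, by simpa using hc⟩
  have h2 : ∀ z : ZMod 2, z = 0 ∨ z = 1 := by decide
  rcases h2 (PadicInt.toZMod x) with h | h
  · obtain ⟨c, hc⟩ := key x h
    exact ⟨c, Or.inl hc⟩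
  · obtain ⟨c, hc⟩ := key (x - 1) (by simp [h])
    exact ⟨c, Or.inr (by rw [← hc]; ring)⟩

theorem padic_of_integral (x : ℚ_[2]) (hx : IsIntegral ℤ x) : ∃ y : ℤ_[2], (y : ℚ_[2]) = x := by
  have h : IsIntegral ℤ_[2] x := hx.tower_top
  exact IsIntegrallyClosed.isIntegral_iff.mp h

theorem sum_sq_even (A B N : ℤ_[2]) (h : A ^ 2 + B ^ 2 = 4 * N) :
    (∃ c, A = 2 * c) ∧ ∃ d, B = 2 * d := by
  obtain ⟨c, hc⟩ := padicInt_parity A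
  obtain ⟨d, hd⟩ := padicInt_parity B
  have h4 : (4 : ZMod (2 ^ 2)) = 0 := by decide
  have h1 : (1 : ZMod (2 ^ 2)) ≠ 0 := by decide
  have h2 : (2 : ZMod (2 ^ 2)) ≠ 0 := by decide
  rcases hc with rfl | rfl <;> rcases hd with rfl | rfl
  · exact ⟨⟨_, rfl⟩, ⟨_, rfl⟩⟩
  all_goals
    exfalso
    have := congrArg (PadicInt.toZModPow (p := 2) 2) h
    simp only [map_add, map_mul, map_pow, map_one, map_ofNat] at this
  · apply h1; linear_combination this + h4 * (PadicInt.toZModPow 2 N - PadicInt.toZModPow 2 c ^ 2 - PadicInt.toZModPow 2 d ^ 2 - PadicInt.toZModPow 2 d)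
  · apply h1; linear_combination this + h4 * (PadicInt.toZModPow 2 N - PadicInt.toZModPow 2 c ^ 2 - PadicInt.toZModPow 2 d ^ 2 - PadicInt.toZModPow 2 c)
  · apply h2; linear_combination this + h4 * (PadicInt.toZModPow 2 N - PadicInt.toZModPow 2 c ^ 2 - PadicInt.toZModPow 2 d ^ 2 - PadicInt.toZModPow 2 c - PadicInt.toZModPow 2 d)

theorem re_im_integral (z : QuadraticAlgebra ℚ_[2] (-1) 0) (hz : IsIntegral ℤ z) :
    ∃ a b : ℤ_[2], z = ⟨(a : ℚ_[2]), (b : ℚ_[2])⟩ := by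
  have hs : IsIntegral ℤ (star z) := by
    have := hz.map (starRingEnd (QuadraticAlgebra ℚ_[2] (-1) 0)).toIntAlgHom
    exact this
  have inj : Function.Injective (algebraMap ℚ_[2] (QuadraticAlgebra ℚ_[2] (-1) 0)) :=
    QuadraticAlgebra.algebraMap_injective
  have ht : IsIntegral ℤ (2 * z.re) := by
    rw [← isIntegral_algebraMap_iff inj]
    have e : algebraMap ℚ_[2] (QuadraticAlgebra ℚ_[2] (-1) 0) (2 * z.re) = z + star z := by
      ext
      · simp; ring
      · simp
    rw [e]
    exact hz.add hs
  have hn : IsIntegral ℤ (z.re ^ 2 + z.im ^ 2) := by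
    rw [← isIntegral_algebraMap_iff inj]
    have e : algebraMap ℚ_[2] (QuadraticAlgebra ℚ_[2] (-1) 0) (z.re ^ 2 + z.im ^ 2)
        = z * star z := by
      rw [QuadraticAlgebra.algebraMap_eq]
      ext
      · simp; ring
      · simp; ring
    rw [e]
    exact hz.mul hs
  obtain ⟨A, hA⟩ := padic_of_integral _ ht
  obtain ⟨N, hN⟩ := padic_of_integral _ hn
  have hb : IsIntegral ℤ (2 * z.im) := by
    apply IsIntegral.of_pow (n := 2) (by norm_num)
    have : (2 * z.im) ^ 2 = 4 * (z.re ^ 2 + z.im ^ 2) - (2 * z.re) ^ 2 := by ring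
    rw [this]
    have h4 : IsIntegral ℤ (4 : ℚ_[2]) := by
      have := isIntegral_algebraMap (R := ℤ) (A := ℚ_[2]) (x := 4)
      simpa using this
    exact (h4.mul hn).sub (ht.pow 2)
  obtain ⟨B, hB⟩ := padic_of_integral _ hb
  have key : A ^ 2 + B ^ 2 = 4 * N := by
    apply Subtype.coe_injective
    push_cast
    have h4 : ((4 : ℤ_[2]) : ℚ_[2]) = 4 := rfl
    rw [hA, hB, hN, h4]; ring
  obtain ⟨⟨c, rfl⟩, ⟨d, rfl⟩⟩ := sum_sq_even A B N key
  refine ⟨c, d, ?_⟩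
  push_cast at hA hB
  have h2 : (2 : ℚ_[2]) ≠ 0 := by norm_num
  ext
  · exact (mul_left_cancel₀ h2 hA).symm
  · exact (mul_left_cancel₀ h2 hB).symm

theorem exists_residue {K : Type*} [Field K] [NumberField K]
    (ψ : K →+* QuadraticAlgebra ℚ_[2] (-1) 0) :
    ∃ φ : NumberField.RingOfIntegers K →+* ZMod 2, ∀ (x : NumberField.RingOfIntegers K) (a b : ℤ_[2]),
      ψ (x : K) = ⟨(a : ℚ_[2]), (b : ℚ_[2])⟩ → φ x = PadicInt.toZMod a + PadicInt.toZMod b := by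
  have h : ∀ x : NumberField.RingOfIntegers K, ∃ a b : ℤ_[2],
      ψ (x : K) = ⟨(a : ℚ_[2]), (b : ℚ_[2])⟩ := fun x =>
    re_im_integral _ (x.isIntegral_coe.map ψ.toIntAlgHom)
  choose f g hfg using h
  have uniq : ∀ (x : NumberField.RingOfIntegers K) (a b : ℤ_[2]),
      ψ (x : K) = ⟨(a : ℚ_[2]), (b : ℚ_[2])⟩ → f x = a ∧ g x = b := by
    intro x a b hx
    rw [hfg x] at hx
    injection hx with h1 h2
    exact ⟨Subtype.coe_injective h1, Subtype.coe_injective h2⟩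
  have neg1 : (-1 : ZMod 2) = 1 := by decide
  refine ⟨⟨⟨⟨fun x => PadicInt.toZMod (f x) + PadicInt.toZMod (g x), ?_⟩, ?_⟩, ?_, ?_⟩, ?_⟩
  · obtain ⟨h1, h2⟩ := uniq 1 1 0 (by ext <;> simp)
    simp [h1, h2]
  · intro x y
    obtain ⟨h1, h2⟩ := uniq (x * y) (f x * f y - g x * g y) (f x * g y + g x * f y)
      (by ext <;> simp [hfg] <;> ring)
    simp only [h1, h2, map_add, map_sub, map_mul]
    linear_combination (PadicInt.toZMod (g x) * PadicInt.toZMod (g y)) * neg1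
  · obtain ⟨h1, h2⟩ := uniq 0 0 0 (by ext <;> simp)
    simp [h1, h2]
  · intro x y
    obtain ⟨h1, h2⟩ := uniq (x + y) (f x + f y) (g x + g y)
      (by ext <;> simp [hfg])
    simp only [h1, h2, map_add]
    ring
  · intro x a b hx
    obtain ⟨h1, h2⟩ := uniq x a b hx
    simp [h1, h2]

theorem exists_root (t : ℕ) (ht : Odd t) (k : ℤ) :
    ∃ w c : ℤ_[2], w ^ (4 * t) = 1 + 16 * (k : ℤ_[2]) ∧ w = 1 + 4 * c := by
  obtain ⟨a, ha4, ha⟩ : ∃ a : ℤ, (∃ c, a = 1 + 4 * c) ∧ (32 : ℤ) ∣ a ^ (4 * t) - (1 + 16 * k) := by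
    rcases Int.even_or_odd k with ⟨j, rfl⟩ | ⟨j, rfl⟩
    · exact ⟨1, ⟨0, by norm_num⟩, ⟨-j, by simp; ring⟩⟩
    · refine ⟨5, ⟨1, by norm_num⟩, ?_⟩
      obtain ⟨s, rfl⟩ := ht
      have h1 : (5 : ℤ) ^ (4 * (2 * s + 1)) ≡ 17 [ZMOD 32] := by
        have : (5 : ℤ) ^ (4 * (2 * s + 1)) = (5 ^ 8) ^ s * 5 ^ 4 := by
          rw [← pow_mul, ← pow_add]; congr 1; ring
        rw [this]
        have h8 : (5 : ℤ) ^ 8 ≡ 1 [ZMOD 32] := by decide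
        have h44 : (5 : ℤ) ^ 4 ≡ 17 [ZMOD 32] := by decide
        simpa using (h8.pow s).mul h44
      have h2 := h1.symm.dvd
      have : (5 : ℤ) ^ (4 * (2 * s + 1)) - (1 + 16 * (2 * j + 1))
        = (5 ^ (4 * (2 * s + 1)) - 17) + 32 * (-j) := by ring
      rw [this]
      exact dvd_add h2 (dvd_mul_right _ _)
  obtain ⟨M, hM⟩ : ∃ M : ℤ, M = 1 + 16 * k := ⟨_, rfl⟩
  obtain ⟨N, hN⟩ : ∃ N : ℕ, N = 4 * t := ⟨_, rfl⟩
  have hMz : (1 + 16 * (k : ℤ_[2])) = M := by rw [hM]; push_cast; rfl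
  rw [hMz]
  rw [← hM, ← hN] at ha
  rw [← hN]
  set F : ℤ[X] := X ^ N - C M with hF
  have haodd : Odd a := by
    obtain ⟨c, rfl⟩ := ha4
    exact ⟨2 * c, by ring⟩
  have e1 : F.aeval (a : ℤ_[2]) = ((a ^ N - M : ℤ) : ℤ_[2]) := by
    simp [hF]
  have e2 : F.derivative.aeval (a : ℤ_[2]) = 4 * ((t * a ^ (N - 1) : ℤ) : ℤ_[2]) := by
    have e3 : F.derivative.aeval (a : ℤ_[2]) = (N : ℤ_[2]) * (a : ℤ_[2]) ^ (N - 1) := by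
      simp [hF, derivative_X_pow]
    have e4 : (N : ℤ_[2]) = 4 * (t : ℤ_[2]) := by rw [hN]; push_cast; rfl
    rw [e3, e4]; push_cast; ring
  have n1 : ‖F.aeval (a : ℤ_[2])‖ ≤ 1 / 32 := by
    rw [e1]
    have := (PadicInt.norm_int_le_pow_iff_dvd (p := 2) (k := a ^ N - M) (n := 5)).2
      (by norm_num; exact ha)
    refine this.trans ?_
    norm_num
  have n4 : ‖(4 : ℤ_[2])‖ = 1 / 4 := by
    have : (4 : ℤ_[2]) = (2 : ℕ) ^ 2 := by norm_num
    rw [this, PadicInt.norm_p_pow]; norm_num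
  have n2 : ‖F.derivative.aeval (a : ℤ_[2])‖ = 1 / 4 := by
    rw [e2, norm_mul, n4]
    have : ‖((t * a ^ (N - 1) : ℤ) : ℤ_[2])‖ = 1 := by
      apply le_antisymm (PadicInt.norm_le_one _)
      rw [← not_lt, PadicInt.norm_int_lt_one_iff_dvd]
      have : Odd ((t : ℤ) * a ^ (N - 1)) := (by exact_mod_cast ht : Odd (t : ℤ)).mul haodd.pow
      intro h
      rw [← Int.not_even_iff_odd] at this
      exact this (even_iff_two_dvd.2 (by exact_mod_cast h))
    rw [this]; norm_num
  obtain ⟨z, hz, hza, -⟩ := hensels_lemma (F := F) (a := (a : ℤ_[2]))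
    (by rw [n2]; refine n1.trans_lt (by norm_num))
  rw [n2] at hza
  have hd : (4 : ℤ_[2]) ∣ z - a := by
    have h : ‖z - a‖ ≤ (2 : ℕ) ^ (-(2 : ℕ) : ℤ) := by
      refine hza.le.trans (by norm_num)
    rw [PadicInt.norm_le_pow_iff_mem_span_pow, Ideal.mem_span_singleton] at h
    norm_num at h
    exact h
  obtain ⟨d, hd⟩ := hd
  obtain ⟨c, rfl⟩ := ha4
  refine ⟨z, c + d, ?_, ?_⟩
  · simp [hF] at hz
    linear_combination hz
  · push_cast at hd
    linear_combination hd

theorem cancel4 (z z' : QuadraticAlgebra ℚ_[2] (-1) 0) (h : 4 * z = 4 * z') : z = z' := by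
  have h1 := congrArg QuadraticAlgebra.re h
  have h2 := congrArg QuadraticAlgebra.im h
  ext
  · simpa using h1
  · simpa using h2

theorem exists_embedding {K : Type*} [Field K] [NumberField K] (n : ℕ) (m : ℤ) (hn : 2 ≤ n)
    (hirr : Irreducible ((X : ℤ[X]) ^ n - C m))
    (α : K) (hroot : Polynomial.aeval α ((X : ℤ[X]) ^ n - C m) = 0)
    (hgen : Algebra.adjoin ℚ {α} = ⊤) (y : QuadraticAlgebra ℚ_[2] (-1) 0) (hy : y ^ n = m) :
    ∃ ψ : K →+* QuadraticAlgebra ℚ_[2] (-1) 0, ψ α = y := by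
  have hmon : ((X : ℤ[X]) ^ n - C m).Monic := monic_X_pow_sub_C m (by omega)
  have hint : IsIntegral ℤ α := ⟨_, hmon, hroot⟩
  have hmin : minpoly ℚ α = X ^ n - C (m : ℚ) := by
    symm
    have h2 := (hmon.irreducible_iff_irreducible_map_fraction_map (K := ℚ)).1 hirr
    have e : ((X : ℤ[X]) ^ n - C m).map (algebraMap ℤ ℚ) = X ^ n - C (m : ℚ) := by simp
    rw [e] at h2
    refine minpoly.eq_of_irreducible_of_monic h2 ?_ (monic_X_pow_sub_C _ (by omega))
    simpa using hroot
  have hintQ : IsIntegral ℚ α := hint.tower_top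
  let pb := PowerBasis.ofAdjoinEqTop hintQ hgen
  have hg : pb.gen = α := PowerBasis.ofAdjoinEqTop_gen hintQ hgen
  have hy' : aeval y (minpoly ℚ pb.gen) = 0 := by
    rw [hg, hmin]
    simp [hy]
  refine ⟨(pb.lift y hy').toRingHom, ?_⟩
  have := pb.lift_gen y hy'
  rw [hg] at this
  exact this

theorem hom_ext_of_odd_index {R : Type*} [CommRing R] (θ : R)
    (hodd : ¬ 2 ∣ (Subalgebra.toSubmodule (Algebra.adjoin ℤ {θ})).toAddSubgroup.index)
    (f g : R →+* ZMod 2) (h : f θ = g θ) : f = g := by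
  ext x
  set d := (Subalgebra.toSubmodule (Algebra.adjoin ℤ {θ})).toAddSubgroup.index with hd
  have hmem : d • x ∈ Algebra.adjoin ℤ {θ} :=
    AddSubgroup.nsmul_index_mem (Subalgebra.toSubmodule (Algebra.adjoin ℤ {θ})).toAddSubgroup x
  have hagree : ∀ y ∈ Algebra.adjoin ℤ {θ}, f y = g y := by
    intro y hy
    have : Algebra.adjoin ℤ {θ} ≤ AlgHom.equalizer f.toIntAlgHom g.toIntAlgHom := by
      rw [Algebra.adjoin_le_iff]
      rintro _ rfl
      exact h
    exact this hy
  have hd1 : (d : ZMod 2) = 1 := by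
    rw [ZMod.natCast_eq_one_iff_odd, ← Nat.not_even_iff_odd, even_iff_two_dvd]
    exact hodd
  have := hagree _ hmem
  rw [map_nsmul, map_nsmul, nsmul_eq_mul, nsmul_eq_mul, hd1, one_mul, one_mul] at this
  exact this

theorem integral_gamma {K : Type*} [Field K] [NumberField K] (β : K) (k : ℤ)
    (hβ : β ^ 4 = 1 + 16 * (k : K)) : IsIntegral ℤ ((1 + β) * (1 + β ^ 2) / 4) := by
  refine ⟨X ^ 4 - X ^ 3 - C (6 * k) * X ^ 2 - C (16 * k ^ 2) * X - C (16 * k ^ 3), by monicity!, ?_⟩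
  have hk : (k : K) = (β ^ 4 - 1) / 16 := by rw [hβ]; field_simp; ring
  simp only [eval₂_sub, eval₂_mul, eval₂_C, eval₂_X_pow, eval₂_X]
  simp only [eq_intCast]
  push_cast
  rw [hk]
  ring

theorem integral_delta {K : Type*} [Field K] [NumberField K] (β : K) (k : ℤ)
    (hβ : β ^ 4 = 1 + 16 * (k : K)) : IsIntegral ℤ ((1 + β ^ 2) / 2) := by
  refine ⟨X ^ 2 - X - C (4 * k), by monicity!, ?_⟩
  have hk : (k : K) = (β ^ 4 - 1) / 16 := by rw [hβ]; field_simp; ring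
  simp only [eval₂_sub, eval₂_C, eval₂_X_pow, eval₂_X]
  simp only [eq_intCast]
  push_cast
  rw [hk]
  ring

theorem two_dvd_index
    {K : Type*} [Field K] [NumberField K] (n : ℕ) (m : ℤ) (hn : 2 ≤ n)
    (hirr : Irreducible ((X : ℤ[X]) ^ n - C m))
    (α : K) (hroot : Polynomial.aeval α ((X : ℤ[X]) ^ n - C m) = 0)
    (hgen : Algebra.adjoin ℚ {α} = ⊤)
    (t : ℕ) (hnt : n = 4 * t) (ht : Odd t) (k : ℤ) (hm : m = 1 + 16 * k)
    (θ : NumberField.RingOfIntegers K) :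
    2 ∣ (Subalgebra.toSubmodule (Algebra.adjoin ℤ {θ})).toAddSubgroup.index := by
  obtain ⟨w, c0, hw, hwc⟩ := exists_root t ht k
  obtain ⟨c, hc⟩ : ∃ c, w ^ t = 1 + 4 * c := by
    have h1 : w - 1 ∣ w ^ t - 1 := sub_one_dvd_pow_sub_one w t
    have h2 : (4 : ℤ_[2]) ∣ w - 1 := ⟨c0, by rw [hwc]; ring⟩
    obtain ⟨c, hc⟩ := h2.trans h1
    exact ⟨c, by linear_combination hc⟩
  let ι : ℤ_[2] →+* QuadraticAlgebra ℚ_[2] (-1) 0 :=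
    (algebraMap ℚ_[2] (QuadraticAlgebra ℚ_[2] (-1) 0)).comp (algebraMap ℤ_[2] ℚ_[2])
  have hι : ∀ a : ℤ_[2], ι a = ⟨(a : ℚ_[2]), ((0 : ℤ_[2]) : ℚ_[2])⟩ := fun a => rfl
  have hwn : ι w ^ n = m := by
    rw [← map_pow, hnt, hw, hm]
    simp only [map_add, map_mul, map_one, map_ofNat, map_intCast]
    push_cast; rfl
  have hwt : ι w ^ t = 1 + 4 * ι c := by
    rw [← map_pow, hc]
    simp only [map_add, map_mul, map_one, map_ofNat]
  let I : QuadraticAlgebra ℚ_[2] (-1) 0 := ⟨0, 1⟩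
  have hI : I ^ 2 = -1 := by
    rw [sq]; ext <;> simp [I]
  have hEven : Even n := ⟨2 * t, by omega⟩
  obtain ⟨ψ₁, h1⟩ := exists_embedding n m hn hirr α hroot hgen (ι w) hwn
  obtain ⟨ψ₂, h2⟩ := exists_embedding n m hn hirr α hroot hgen (-ι w) (by rw [hEven.neg_pow, hwn])
  obtain ⟨ψ₃, h3⟩ := exists_embedding n m hn hirr α hroot hgen (I * ι w) (by
    rw [mul_pow, hwn, hnt, show 4 * t = 2 * (2 * t) by ring, pow_mul, hI,
      (even_two_mul t).neg_one_pow, one_mul])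
  obtain ⟨φ₁, g1⟩ := exists_residue ψ₁
  obtain ⟨φ₂, g2⟩ := exists_residue ψ₂
  obtain ⟨φ₃, g3⟩ := exists_residue ψ₃
  have hαn : α ^ n = m := by
    have := hroot
    simp at this
    linear_combination this
  have hβ : (α ^ t) ^ 4 = 1 + 16 * (k : K) := by
    rw [← pow_mul, mul_comm t 4, ← hnt, hαn, hm]; push_cast; rfl
  obtain ⟨γ, hγ⟩ : ∃ γ : NumberField.RingOfIntegers K,
      (γ : K) = (1 + α ^ t) * (1 + (α ^ t) ^ 2) / 4 := ⟨⟨_, integral_gamma _ k hβ⟩, rfl⟩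
  obtain ⟨δ, hδ⟩ : ∃ δ : NumberField.RingOfIntegers K,
      (δ : K) = (1 + (α ^ t) ^ 2) / 2 := ⟨⟨_, integral_delta _ k hβ⟩, rfl⟩
  have hγ4 : 4 * (γ : K) = (1 + α ^ t) * (1 + (α ^ t) ^ 2) := by rw [hγ]; field_simp
  have hδ4 : 4 * (δ : K) = 2 * (1 + (α ^ t) ^ 2) := by rw [hδ]; field_simp; ring
  have b1 : ψ₁ (α ^ t) = 1 + 4 * ι c := by rw [map_pow, h1, hwt]
  have b2 : ψ₂ (α ^ t) = -(1 + 4 * ι c) := by rw [map_pow, h2, ht.neg_pow, hwt]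
  have b3 : ψ₃ (α ^ t) ^ 2 = -(1 + 4 * ι c) ^ 2 := by
    rw [map_pow, h3, mul_pow, hwt, mul_pow, ← pow_mul, mul_comm t 2, pow_mul, hI, ht.neg_one_pow]
    ring
  have z2 : (2 : ZMod 2) = 0 := by decide
  have z4 : (4 : ZMod 2) = 0 := by decide
  have z8 : (8 : ZMod 2) = 0 := by decide
  have vγ : ∀ (ψ : K →+* QuadraticAlgebra ℚ_[2] (-1) 0),
      4 * ψ γ = (1 + ψ (α ^ t)) * (1 + ψ (α ^ t) ^ 2) := by
    intro ψ
    have := congrArg ψ hγ4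
    simpa only [map_mul, map_add, map_one, map_ofNat, map_pow] using this
  have vδ : ∀ (ψ : K →+* QuadraticAlgebra ℚ_[2] (-1) 0),
      4 * ψ δ = 2 * (1 + ψ (α ^ t) ^ 2) := by
    intro ψ
    have := congrArg ψ hδ4
    simpa only [map_mul, map_add, map_one, map_ofNat, map_pow] using this
  have c1 : φ₁ γ = 1 := by
    rw [g1 γ ((1 + 2 * c) * (1 + 4 * c + 8 * c ^ 2)) 0]
    · simp only [map_add, map_sub, map_neg, map_mul, map_pow, map_one, map_zero, map_ofNat]; simp [z2, z4, z8]
    · rw [← hι]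
      apply cancel4
      rw [vγ, b1]
      simp only [map_mul, map_add, map_one, map_ofNat, map_pow]
      ring
  have c2 : φ₂ γ = 0 := by
    rw [g2 γ (2 * (-c * (1 + 4 * c + 8 * c ^ 2))) 0]
    · simp only [map_add, map_sub, map_neg, map_mul, map_pow, map_one, map_zero, map_ofNat]; simp [z2, z4, z8]
    · rw [← hι]
      apply cancel4
      rw [vγ, b2]
      simp only [map_mul, map_add, map_one, map_ofNat, map_pow, map_neg]
      ring
  have d1 : φ₁ δ = 1 := by
    rw [g1 δ (1 + 4 * c + 8 * c ^ 2) 0]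
    · simp only [map_add, map_sub, map_neg, map_mul, map_pow, map_one, map_zero, map_ofNat]; simp [z2, z4, z8]
    · rw [← hι]
      apply cancel4
      rw [vδ, b1]
      simp only [map_mul, map_add, map_one, map_ofNat, map_pow]
      ring
  have d2 : φ₂ δ = 1 := by
    rw [g2 δ (1 + 4 * c + 8 * c ^ 2) 0]
    · simp only [map_add, map_sub, map_neg, map_mul, map_pow, map_one, map_zero, map_ofNat]; simp [z2, z4, z8]
    · rw [← hι]
      apply cancel4
      rw [vδ, b2]
      simp only [map_mul, map_add, map_one, map_ofNat, map_pow]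
      ring
  have d3 : φ₃ δ = 0 := by
    rw [g3 δ (2 * (-2 * c - 4 * c ^ 2)) 0]
    · simp only [map_add, map_sub, map_neg, map_mul, map_pow, map_one, map_zero, map_ofNat]; simp [z2, z4, z8]
    · rw [← hι]
      apply cancel4
      rw [vδ, b3]
      simp only [map_mul, map_sub, map_one, map_ofNat, map_pow, map_neg]
      ring
  by_contra hodd
  have pig : ∀ a b c : ZMod 2, a = b ∨ a = c ∨ b = c := by decide
  rcases pig (φ₁ θ) (φ₂ θ) (φ₃ θ) with h | h | h
  · have := hom_ext_of_odd_index θ hodd _ _ h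
    rw [this, c2] at c1
    exact absurd c1 (by decide)
  · have := hom_ext_of_odd_index θ hodd _ _ h
    rw [this, d3] at d1
    exact absurd d1 (by decide)
  · have := hom_ext_of_odd_index θ hodd _ _ h
    rw [this, d3] at d2
    exact absurd d2 (by decide)

/-- Let `f(x) = x^n - m` be monic irreducible, `n ≥ 2`, `n = 2^r·t` with `t` odd, and
`K = ℚ(α)` for a root `α` of `f`. If `m` is odd, `r = 2`, and `ν_2(m-1) ≥ 4`, then `2`
divides `(𝓞_K : ℤ[θ])` for every generator `θ ∈ 𝓞_K` of `K`; in particular `K` is not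
monogenic. -/
theorem not_monogenic_case4
    {K : Type*} [Field K] [NumberField K] (n : ℕ) (m : ℤ) (hn : 2 ≤ n)
    (hirr : Irreducible ((X : ℤ[X]) ^ n - C m))
    (α : K) (hroot : Polynomial.aeval α ((X : ℤ[X]) ^ n - C m) = 0)
    (hgen : Algebra.adjoin ℚ {α} = ⊤)
    (r t : ℕ) (hnrt : n = 2 ^ r * t) (ht : Odd t)
    (hm : Odd m) (hr : r = 2) (hval : padicValInt 2 (m - 1) ≥ 4) :
    (∀ θ : NumberField.RingOfIntegers K, Algebra.adjoin ℚ {(θ : K)} = ⊤ →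
        2 ∣ (Subalgebra.toSubmodule (Algebra.adjoin ℤ {θ})).toAddSubgroup.index) ∧
      ¬ ∃ θ : NumberField.RingOfIntegers K, Algebra.adjoin ℤ {θ} = ⊤ := by
  have hdvd : (16 : ℤ) ∣ m - 1 := by
    have h : ((2 : ℕ) : ℤ) ^ 4 ∣ m - 1 := (padicValInt_dvd_iff 4 (m - 1)).2 (Or.inr hval)
    norm_num at h
    exact h
  obtain ⟨k, hk⟩ := hdvd
  have hnt : n = 4 * t := by rw [hnrt, hr]; norm_num
  have key := two_dvd_index n m hn hirr α hroot hgen t hnt ht k (by linarith)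
  refine ⟨fun θ _ => key θ, ?_⟩
  rintro ⟨θ, hθ⟩
  have h := key θ
  rw [hθ] at h
  simp at h
end

section
/- Let f(x) = x^n − m ∈ ℤ[x] be a monic irreducible polynomial with n ≥ 2, write n = 2^r · t with t odd, and let K = ℚ(α) for a complex root α of f. If m is odd, r ≥ 3, and ν_2(m − 1) ≥ 5, then 2 divides the index (𝓞_K : ℤ[θ]) for every θ ∈ 𝓞_K generating K over ℚ; in particular K is not monogenic. -/
open Polynomial

lemma normTwo : ‖(2 : PadicAlgCl 2)‖ = 1/2 := by
  have := PadicAlgCl.norm_extends 2 (2 : ℚ_[2])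
  have h2 := Padic.norm_p (p := 2)
  rw [map_ofNat] at this
  rw [this]; simpa using h2

lemma norm_sub_one_sq (y : PadicAlgCl 2) (h1 : 1/2 ≤ ‖y^2-1‖) : ‖y-1‖^2 = ‖y^2-1‖ := by
  have hf : y^2-1 = (y-1)*(y-1+2) := by ring
  rw [hf, norm_mul] at h1 ⊢
  rcases eq_or_ne ‖y-1‖ ‖(2 : PadicAlgCl 2)‖ with h | h
  · have := IsUltrametricDist.norm_add_le_max (y-1) (2 : PadicAlgCl 2)
    rw [h, max_self] at this
    rw [h] at h1
    rw [normTwo] at *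
    linarith
  · have h3 := IsUltrametricDist.norm_add_eq_max_of_norm_ne_norm h
    rw [normTwo] at h3
    rw [h3] at h1 ⊢
    rcases max_cases ‖y-1‖ (1/2) with ⟨h4, h5⟩ | ⟨h4, h5⟩
    · rw [h4]; ring
    · rw [h4] at h1; linarith

lemma norm_sub_one_pow (a : ℕ) : ∀ (y : PadicAlgCl 2), ‖y^(2^a)-1‖ = 1/2 → ‖y-1‖^(2^a) = 1/2 := by
  induction a with
  | zero => intro y h; simpa using h
  | succ a ih =>
    intro y h
    have h1 := ih (y^2) (by rw [← pow_mul, ← pow_succ']; exact h)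
    have h2 : 1/2 ≤ ‖y^2-1‖ := by
      by_contra! hlt
      have : ‖y^2-1‖^(2^a) ≤ ‖y^2-1‖ ^ 1 :=
        pow_le_pow_of_le_one (norm_nonneg _) (by linarith) (Nat.one_le_two_pow)
      linarith
    rw [pow_succ', pow_mul, norm_sub_one_sq y h2, h1]

/-- distinctness of the norms -/
lemma terms_ne (π : PadicAlgCl 2) (e : ℕ) (he : 0 < e) (hπ : ‖π‖^e = 1/2) (a b : ℚ_[2]) (ha : a ≠ 0)
    (hb : b ≠ 0) (i j : ℕ) (hi : i < e) (hj : j < e)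
    (h : ‖algebraMap ℚ_[2] (PadicAlgCl 2) a * π^i‖ = ‖algebraMap ℚ_[2] (PadicAlgCl 2) b * π^j‖) : i = j := by
  rw [norm_mul, norm_mul, norm_pow, norm_pow, PadicAlgCl.norm_extends, PadicAlgCl.norm_extends,
    Padic.norm_eq_zpow_neg_valuation ha, Padic.norm_eq_zpow_neg_valuation hb] at h
  have h2 := congrArg (fun z : ℝ => z^e) h
  simp only [mul_pow, ← pow_mul] at h2
  rw [mul_comm i, mul_comm j, pow_mul, pow_mul, hπ] at h2
  have h3 : ((2:ℝ)^(-a.valuation * e - i) : ℝ) = 2^(-b.valuation * e - j) := by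
    rw [zpow_sub₀ (by norm_num), zpow_sub₀ (by norm_num), zpow_mul, zpow_mul]
    simp only [zpow_natCast, div_eq_mul_inv]
    simpa using h2
  have h4 := zpow_right_injective₀ (by norm_num) (by norm_num) h3
  have h5 : (e:ℤ) * (b.valuation - a.valuation) = i - j := by linarith
  have h6 : (e:ℤ) ∣ (i:ℤ) - j := ⟨_, h5.symm⟩
  have h7 := Int.eq_zero_of_abs_lt_dvd h6 (by rw [abs_lt]; omega)
  omega

lemma coeff_le (π : PadicAlgCl 2) (e : ℕ) (he : 0 < e) (hπ : ‖π‖^e = 1/2) (p : ℚ_[2][X])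
    (hp : p.natDegree < e) (hx : ‖aeval π p‖ ≤ 1) (i : ℕ) : ‖p.coeff i‖ ≤ 1 := by
  by_cases hi : p.coeff i = 0
  · simp [hi]
  have hmem : i ∈ p.support := by simpa using hi
  have hlt : ∀ j ∈ p.support, j < e := fun j hj => (le_natDegree_of_mem_supp j hj).trans_lt hp
  have h1 := IsUltrametricDist.nnnorm_sum_eq_sup_of_pairwise_ne (s := p.support)
    (f := fun j => algebraMap ℚ_[2] (PadicAlgCl 2) (p.coeff j) * π^j) (by
      intro j hj k hk hjk h
      apply hjk
      refine terms_ne π e he hπ _ _ (by simpa using hj) (by simpa using hk) j k (hlt j hj) (hlt k hk) ?_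
      exact congrArg NNReal.toReal h)
  have h2 : aeval π p = ∑ j ∈ p.support, algebraMap ℚ_[2] (PadicAlgCl 2) (p.coeff j) * π^j := by
    rw [aeval_def, eval₂_eq_sum, sum_def]
  have h3 := Finset.le_sup (f := fun j => ‖algebraMap ℚ_[2] (PadicAlgCl 2) (p.coeff j) * π^j‖₊) hmem
  rw [← h1, ← h2] at h3
  have h4 : ‖algebraMap ℚ_[2] (PadicAlgCl 2) (p.coeff i) * π^i‖ ≤ 1 := le_trans (by exact_mod_cast h3) hx
  rw [norm_mul, norm_pow, PadicAlgCl.norm_extends] at h4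
  by_contra! hc
  have hc2 : 2 ≤ ‖p.coeff i‖ := by
    rw [Padic.norm_eq_zpow_neg_valuation hi] at hc ⊢
    have : (0:ℤ) < -(p.coeff i).valuation := by
      by_contra! hh
      exact absurd hc (not_lt.mpr (zpow_le_one_of_nonpos₀ (by norm_num) hh))
    calc (2:ℝ) = 2^(1:ℤ) := by norm_num
      _ ≤ _ := zpow_le_zpow_right₀ (by norm_num) (by omega)
  have hπ1 : ‖π‖ < 1 := by
    by_contra! hh
    have := one_le_pow₀ hh (n := e)
    linarith
  have hπ0 : 0 < ‖π‖ := by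
    rcases (norm_nonneg π).lt_or_eq with h | h
    · exact h
    · rw [← h, zero_pow he.ne'] at hπ; norm_num at hπ
  have h5 : 1/2 < ‖π‖^i := by rw [← hπ]; exact pow_lt_pow_right_of_lt_one₀ hπ0 hπ1 (hlt i hmem)
  nlinarith

lemma padic_res (a : ℚ_[2]) (ha : ‖a‖ ≤ 1) : ‖a‖ < 1 ∨ ‖a - 1‖ < 1 := by
  obtain ⟨n, hn, h⟩ := PadicInt.exists_mem_range (p := 2) ⟨a, ha⟩
  rw [PadicInt.maximalIdeal_eq_span_p, Ideal.mem_span_singleton, ← PadicInt.norm_lt_one_iff_dvd,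
    PadicInt.norm_def] at h
  interval_cases n
  · left; simpa using (show ‖a - ((0:ℕ):ℤ_[2])‖ < 1 from h)
  · right; simpa using (show ‖a - ((1:ℕ):ℤ_[2])‖ < 1 from h)

lemma residue (γ : PadicAlgCl 2) (a : ℕ) (c : ℚ_[2]) (hγ : γ^(2^a) = algebraMap _ _ c)
    (hc : ‖c-1‖ = 1/2) (p : ℚ_[2][X]) (hx : ‖aeval γ p‖ ≤ 1) :
    ‖aeval γ p‖ < 1 ∨ ‖aeval γ p - 1‖ < 1 := by
  have he : 0 < 2^a := by positivity
  have hπ : ‖γ-1‖^(2^a) = 1/2 := by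
    apply norm_sub_one_pow
    rw [hγ, ← map_one (algebraMap ℚ_[2] (PadicAlgCl 2)), ← map_sub, PadicAlgCl.norm_extends, hc]
  set π := γ - 1 with hπd
  have hπ1 : ‖π‖ < 1 := by
    by_contra! hh
    have := one_le_pow₀ hh (n := 2^a)
    linarith
  let Q : ℚ_[2][X] := (X^(2^a) - C c).comp (X + C 1)
  have hQm : Q.Monic := (monic_X_pow_sub_C c he.ne').comp_X_add_C 1
  have hQd : Q.natDegree = 2^a := by
    rw [natDegree_comp, natDegree_X_add_C, natDegree_X_pow_sub_C, mul_one]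
  have hQ0 : aeval π Q = 0 := by simp [Q, aeval_comp, hπd, hγ]
  let q := (p.comp (X + C 1)) %ₘ Q
  have hq : aeval γ p = aeval π q := by
    rw [aeval_modByMonic_eq_self_of_root hQ0]
    simp [aeval_comp, hπd]
  have hqd : q.natDegree < 2^a := by
    rw [← hQd]; exact natDegree_modByMonic_lt _ hQm (by intro h; rw [h, natDegree_one] at hQd; omega)
  rw [hq] at hx ⊢
  have hco := coeff_le π _ he hπ q hqd hx
  -- x - q0 has norm < 1
  have key : ‖aeval π q - algebraMap ℚ_[2] _ (q.coeff 0)‖ < 1 := by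
    have h1 : aeval π q - algebraMap ℚ_[2] _ (q.coeff 0) = π * aeval π q.divX := by
      have h0 := congrArg (aeval π) (divX_mul_X_add q)
      rw [map_add, map_mul, aeval_X, aeval_C] at h0
      rw [← h0]; ring
    have h2 : ‖aeval π q.divX‖ ≤ 1 := by
      rw [aeval_def, eval₂_eq_sum, sum_def]
      apply IsUltrametricDist.norm_sum_le_of_forall_le_of_nonneg zero_le_one
      intro j _
      rw [norm_mul, norm_pow, PadicAlgCl.norm_extends, coeff_divX]
      exact mul_le_one₀ (hco _) (by positivity) (pow_le_one₀ (norm_nonneg _) hπ1.le)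
    rw [h1, norm_mul]
    exact mul_lt_one_of_nonneg_of_lt_one_left (norm_nonneg _) hπ1 h2
  rcases padic_res _ (hco 0) with h | h
  · left
    have := IsUltrametricDist.norm_add_le_max (aeval π q - algebraMap ℚ_[2] _ (q.coeff 0)) (algebraMap ℚ_[2] _ (q.coeff 0))
    rw [sub_add_cancel] at this
    refine this.trans_lt (max_lt key ?_)
    rwa [PadicAlgCl.norm_extends]
  · right
    have := IsUltrametricDist.norm_add_le_max (aeval π q - algebraMap ℚ_[2] _ (q.coeff 0)) (algebraMap ℚ_[2] _ (q.coeff 0 - 1))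
    rw [map_sub, sub_add_sub_cancel, map_one] at this
    refine this.trans_lt (max_lt key ?_)
    rwa [← map_one (algebraMap ℚ_[2] (PadicAlgCl 2)), ← map_sub, PadicAlgCl.norm_extends]

lemma two_dvd_index_aux {R : Type*} [CommRing R] (φ : Fin 3 → (R →+* ZMod 2)) (hφ : Function.Injective φ)
    (θ : R) : 2 ∣ (Subalgebra.toSubmodule (Algebra.adjoin ℤ {θ})).toAddSubgroup.index := by
  by_contra hN
  set N := (Subalgebra.toSubmodule (Algebra.adjoin ℤ {θ})).toAddSubgroup.index with hNd
  obtain ⟨i, j, hij, h⟩ := Fintype.exists_ne_map_eq_of_card_lt (fun i => φ i θ) (by simp [ZMod.card])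
  apply hij
  apply hφ
  ext x
  have hx : (N • x) ∈ Algebra.adjoin ℤ {θ} := AddSubgroup.nsmul_index_mem (Subalgebra.toSubmodule (Algebra.adjoin ℤ {θ})).toAddSubgroup x
  have hNc : (N : ZMod 2) = 1 := by
    rw [ZMod.natCast_eq_one_iff_odd]; exact Nat.not_even_iff_odd.mp (fun h => hN h.two_dvd)
  have key : ∀ y ∈ Algebra.adjoin ℤ {θ}, φ i y = φ j y := by
    intro y hy
    induction hy using Algebra.adjoin_induction with
    | mem x hx => rw [Set.mem_singleton_iff.mp hx]; exact h
    | algebraMap r => simp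
    | add x y _ _ hx hy => simp [hx, hy]
    | mul x y _ _ hx hy => simp [hx, hy]
  have := key _ hx
  simpa [hNc] using this

lemma exists_hom {R : Type*} [CommRing R] (P : Ideal R) (h1 : (1:R) ∉ P) (h : ∀ x, x ∈ P ∨ x - 1 ∈ P) :
    ∃ φ : R →+* ZMod 2, ∀ x, φ x = 0 ↔ x ∈ P := by
  classical
  have h2 : (2:R) ∈ P := by
    rcases h 2 with h | h
    · exact h
    · norm_num at h; exact absurd h h1
  have hn : ∀ x, x ∉ P → x - 1 ∈ P := fun x hx => (h x).resolve_left hx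
  have hn' : ∀ x, x - 1 ∈ P → x ∉ P := fun x hx hx' => h1 (by simpa using P.sub_mem hx' hx)
  have ev : ∀ x b, (b : R) = 0 ∨ b = 1 → x - b ∈ P → ((x ∈ P) ↔ b = 0) := by
    rintro x b (rfl | rfl) hb
    · simpa using hb
    · have : Nontrivial R := ⟨⟨1, 0, fun h => h1 (h ▸ P.zero_mem)⟩⟩
      simpa using hn' x hb
  refine ⟨{ toFun := fun x => if x ∈ P then 0 else 1, map_one' := by simp [h1], map_zero' := by simp, map_mul' := ?_, map_add' := ?_}, ?_⟩
  · intro x y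
    by_cases hx : x ∈ P
    · simp [hx, P.mul_mem_right y hx]
    · by_cases hy : y ∈ P
      · simp [hy, P.mul_mem_left x hy]
      · have : x * y ∉ P := hn' _ (by
          have := P.add_mem (P.mul_mem_right y (hn x hx)) (hn y hy)
          convert this using 1; ring)
        simp [hx, hy, this]
  · intro x y
    by_cases hx : x ∈ P
    · have : x + y ∈ P ↔ y ∈ P := P.add_mem_iff_right hx
      simp [hx, this]
    · by_cases hy : y ∈ P
      · have : x + y ∈ P ↔ x ∈ P := P.add_mem_iff_left hy
        simp [hy, this]
      · have : x + y ∈ P := by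
          have := P.add_mem (P.add_mem (hn x hx) (hn y hy)) h2
          convert this using 1; ring
        simp [hx, hy, this]; decide
  · intro x; simp


lemma isUnit_aux (y : ℤ_[2]) : ‖1 + 2 * y‖ = 1 := by
  have h2 : ‖2 * y‖ < 1 := (PadicInt.norm_lt_one_iff_dvd _).mpr ⟨y, by norm_num⟩
  by_contra h
  have h1 : ‖1 + 2 * y‖ < 1 := lt_of_le_of_ne (PadicInt.norm_le_one _) h
  rw [PadicInt.norm_lt_one_iff_dvd] at h1 h2
  have h3 := (PadicInt.norm_lt_one_iff_dvd (p := 2) _).mpr ((Nat.cast_ofNat (R := ℤ_[2]) (n := 2)) ▸ (dvd_add_left h2).mp h1)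
  simp at h3

lemma dvd_of_norm_lt (x : ℤ_[2]) (k : ℕ) (h : ‖x‖ < 2 * (1/2)^k) : 2^k ∣ x := by
  have := (PadicInt.norm_le_pow_iff_mem_span_pow x k).mp (by
    rw [PadicInt.norm_le_pow_iff_norm_lt_pow_add_one]
    convert h using 1
    rw [zpow_add₀ (by norm_num)]; simp [mul_comm])
  rw [Ideal.mem_span_singleton] at this
  simpa using this

lemma norm_of_dvd (x : ℤ_[2]) (k : ℕ) (h : 2^k ∣ x) : ‖x‖ ≤ (1/2)^k := by
  have := (PadicInt.norm_le_pow_iff_mem_span_pow x k).mpr (by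
    rw [Ideal.mem_span_singleton]; simpa using h)
  simpa using this

lemma norm_two_int : ‖(2 : ℤ_[2])‖ = 1/2 := by
  simpa using PadicInt.norm_p (p := 2)

lemma sqrt_aux (k : ℕ) (hk : 2 ≤ k) (x : ℤ_[2]) (hx : 2^(k+1) ∣ x - 1) : ∃ z, z^2 = x ∧ 2^k ∣ z - 1 := by
  have hD : ‖aeval (1 : ℤ_[2]) (derivative (X^2 - C x : ℤ_[2][X]))‖ = 1/2 := by
    rw [← norm_two_int]; congr 1; simp; norm_num
  have hE : ∀ z : ℤ_[2], aeval z (X^2 - C x : ℤ_[2][X]) = z^2 - x := by intro z; simp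
  obtain ⟨z, hz, hz1, -⟩ := hensels_lemma (p := 2) (F := (X^2 - C x : ℤ_[2][X])) (a := 1) (by
    have h1 := norm_of_dvd _ _ hx
    have h2 : ((1:ℝ)/2)^(k+1) ≤ (1/2)^3 := pow_le_pow_of_le_one (by norm_num) (by norm_num) (by omega)
    rw [norm_sub_rev] at h1
    rw [hD, hE, one_pow]
    norm_num at h1 h2 ⊢
    linarith)
  rw [hD] at hz1
  rw [hE] at hz
  have hzx : z^2 = x := by linear_combination hz
  refine ⟨z, hzx, ?_⟩
  obtain ⟨y, hy⟩ := dvd_of_norm_lt (z-1) 2 (by norm_num; linarith)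
  obtain ⟨c, hc⟩ := hx
  obtain ⟨u, hu⟩ := (PadicInt.isUnit_iff.mpr (isUnit_aux y)).exists_right_inv
  refine ⟨c * u, ?_⟩
  have h2 : (2:ℤ_[2]) ≠ 0 := two_ne_zero
  apply mul_left_cancel₀ h2
  have hz' : z = 1 + 4 * y := by linear_combination hy
  subst hz'
  rw [pow_succ] at hc
  linear_combination (u) * hc - (8 * y) * hu + u * hzx

lemma root_aux (t : ℕ) (ht : Odd t) (v : ℤ_[2]) (hv : 4 ∣ v - 1) : ∃ w, w^t = v ∧ 4 ∣ w - 1 := by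
  have htn : ‖(t : ℤ_[2])‖ = 1 := by
    obtain ⟨s, rfl⟩ := ht
    have := isUnit_aux s
    push_cast; rwa [add_comm]
  have h4 : (4:ℤ_[2]) = 2^2 := by norm_num
  have hD : ‖aeval (1 : ℤ_[2]) (derivative (X^t - C v : ℤ_[2][X]))‖ = 1 := by
    rw [← htn]; congr 1; simp [derivative_X_pow]
  have hE : ∀ z : ℤ_[2], aeval z (X^t - C v : ℤ_[2][X]) = z^t - v := by intro z; simp
  obtain ⟨z, hz, hz1, -⟩ := hensels_lemma (p := 2) (F := (X^t - C v : ℤ_[2][X])) (a := 1) (by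
    have h1 := norm_of_dvd _ 2 (h4 ▸ hv)
    rw [norm_sub_rev] at h1
    rw [hD, hE, one_pow]
    norm_num at h1 ⊢
    linarith)
  rw [hD] at hz1
  rw [hE] at hz
  have hzx : z^t = v := by linear_combination hz
  refine ⟨z, hzx, ?_⟩
  obtain ⟨y, hy⟩ := dvd_of_norm_lt (z-1) 1 (by norm_num; linarith)
  obtain ⟨s, rfl⟩ := ht
  have h5 : (4:ℤ_[2]) ∣ z^2 - 1 := ⟨y * (y+1), by
    have : z = 1 + 2 * y := by linear_combination hy
    rw [this]; ring⟩
  have h6 : z^2 - 1 ∣ (z^2)^s - 1 := sub_one_dvd_pow_sub_one _ _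
  have h7 : z - 1 = (v - 1) - z * ((z^2)^s - 1) := by rw [← hzx]; ring
  rw [h7]
  exact dvd_sub hv ((h5.trans h6).mul_left z)

lemma exists_w (t : ℕ) (ht : Odd t) (m : ℤ) (hm : 32 ∣ m - 1) : ∃ w : ℤ_[2], w^(8*t) = m ∧ 4 ∣ w - 1 := by
  obtain ⟨c, hc⟩ := hm
  obtain ⟨z1, h1, h1'⟩ := sqrt_aux 4 (by norm_num) (m : ℤ_[2]) ⟨c, by
    have := congrArg (Int.cast : ℤ → ℤ_[2]) hc
    push_cast at this; rw [this]; norm_num⟩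
  obtain ⟨z2, h2, h2'⟩ := sqrt_aux 3 (by norm_num) z1 h1'
  obtain ⟨z3, h3, h3'⟩ := sqrt_aux 2 (by norm_num) z2 h2'
  obtain ⟨w, hw, hw'⟩ := root_aux t ht z3 (by norm_num at h3'; exact h3')
  refine ⟨w, ?_, hw'⟩
  rw [mul_comm, pow_mul, hw, ← h1, ← h2, ← h3]; ring

lemma norm_le_one_of_int (y : PadicAlgCl 2) (hy : IsIntegral ℤ y) : ‖y‖ ≤ 1 := by
  obtain ⟨p, hp, h⟩ := hy
  by_contra! hc
  have h1 := hp.as_sum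
  rw [h1, eval₂_add, eval₂_pow, eval₂_X, eval₂_finsetSum] at h
  have h2 : y ^ p.natDegree = - ∑ i ∈ Finset.range p.natDegree, eval₂ (algebraMap ℤ _) y (C (p.coeff i) * X^i) :=
    eq_neg_of_add_eq_zero_left h
  have hd : p.natDegree ≠ 0 := by
    intro h0
    rw [h0] at h2; simp at h2
  have h3 : ‖y^p.natDegree‖ ≤ ‖y‖^(p.natDegree - 1) := by
    rw [h2, norm_neg]
    apply IsUltrametricDist.norm_sum_le_of_forall_le_of_nonneg (by positivity)
    intro i hi
    rw [Finset.mem_range] at hi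
    have h4 : ‖((p.coeff i : ℤ) : PadicAlgCl 2)‖ ≤ 1 := by
      have := PadicAlgCl.norm_extends 2 ((p.coeff i : ℤ) : ℚ_[2])
      rw [map_intCast] at this
      rw [this]; exact Padic.norm_int_le_one _
    rw [eval₂_mul, eval₂_C, eval₂_pow, eval₂_X, eq_intCast, norm_mul, norm_pow]
    calc _ ≤ 1 * ‖y‖^i := by gcongr
      _ = ‖y‖^i := one_mul _
      _ ≤ _ := pow_le_pow_right₀ hc.le (by omega)
  rw [norm_pow] at h3
  have := pow_lt_pow_right₀ hc (show p.natDegree - 1 < p.natDegree by omega)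
  linarith

noncomputable def iotaHom : ℤ_[2] →+* PadicAlgCl 2 := (algebraMap ℚ_[2] (PadicAlgCl 2)).comp PadicInt.Coe.ringHom

lemma norm_iota (x : ℤ_[2]) : ‖iotaHom x‖ = ‖x‖ := by
  unfold iotaHom
  rw [RingHom.comp_apply, PadicAlgCl.norm_extends]; rfl

lemma exists_emb {K : Type*} [Field K] [NumberField K] (n : ℕ) (m : ℤ) (hn : n ≠ 0)
    (hirr : Irreducible ((X : ℤ[X]) ^ n - C m))
    (α : K) (hroot : Polynomial.aeval α ((X : ℤ[X]) ^ n - C m) = 0)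
    (hgen : Algebra.adjoin ℚ {α} = ⊤) (γ : PadicAlgCl 2) (hγ : γ^n = m) :
    ∃ σ : K →ₐ[ℚ] PadicAlgCl 2, σ α = γ := by
  have hmin : minpoly ℚ α = X^n - C (m:ℚ) := by
    symm
    apply minpoly.eq_of_irreducible_of_monic
    · have := (Polynomial.Monic.irreducible_iff_irreducible_map_fraction_map (K := ℚ)
        (monic_X_pow_sub_C m hn)).mp hirr
      simpa using this
    · simpa using hroot
    · exact monic_X_pow_sub_C _ hn
  have hint : IsIntegral ℚ α := Algebra.IsIntegral.isIntegral α
  let pb := PowerBasis.ofAdjoinEqTop hint hgen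
  have hpb : pb.gen = α := PowerBasis.ofAdjoinEqTop_gen hint hgen
  refine ⟨pb.lift γ ?_, ?_⟩
  · rw [hpb, hmin]; simp [hγ]
  · exact (congrArg _ hpb.symm).trans (pb.lift_gen _ _)

lemma exists_data {K : Type*} [Field K] [NumberField K] (n : ℕ) (m : ℤ) (hn : n ≠ 0)
    (hirr : Irreducible ((X : ℤ[X]) ^ n - C m))
    (α : K) (hroot : Polynomial.aeval α ((X : ℤ[X]) ^ n - C m) = 0)
    (hgen : Algebra.adjoin ℚ {α} = ⊤) (γ : PadicAlgCl 2) (hγ : γ^n = m)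
    (a : ℕ) (c : ℤ_[2]) (hc : γ^(2^a) = iotaHom c) (hc1 : ‖c - 1‖ = 1/2) :
    ∃ (σ : K →ₐ[ℚ] PadicAlgCl 2) (φ : NumberField.RingOfIntegers K →+* ZMod 2), σ α = γ ∧
      ∀ x : NumberField.RingOfIntegers K, φ x = 0 ↔ ‖σ x‖ < 1 := by
  obtain ⟨σ, hσ⟩ := exists_emb n m hn hirr α hroot hgen γ hγ
  have hle : ∀ x : NumberField.RingOfIntegers K, ‖σ x‖ ≤ 1 := fun x =>
    norm_le_one_of_int _ ((NumberField.RingOfIntegers.isIntegral_coe x).map (σ.restrictScalars ℤ))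
  let P : Ideal (NumberField.RingOfIntegers K) :=
    { carrier := {x | ‖σ x‖ < 1}
      add_mem' := by
        intro x y hx hy
        simp only [Set.mem_ofPred_eq, map_add] at *
        exact (IsUltrametricDist.norm_add_le_max _ _).trans_lt (max_lt hx hy)
      zero_mem' := by simp
      smul_mem' := by
        intro x y hy
        simp only [Set.mem_ofPred_eq, smul_eq_mul, map_mul, norm_mul] at *
        exact mul_lt_one_of_nonneg_of_lt_one_right (hle x) (norm_nonneg _) hy }
  have hP : ∀ x, x ∈ P ↔ ‖σ x‖ < 1 := fun x => Iff.rfl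
  obtain ⟨φ, hφ⟩ := exists_hom P (by rw [hP]; simp) (by
    intro x
    rw [hP, hP]
    have hx : (x : K) ∈ Algebra.adjoin ℚ {α} := hgen ▸ Algebra.mem_top
    rw [Algebra.adjoin_singleton_eq_range_aeval] at hx
    obtain ⟨p, hp⟩ := hx
    have h1 : σ x = aeval γ (p.map (algebraMap ℚ ℚ_[2])) := by
      rw [← hp, aeval_map_algebraMap, ← hσ]
      exact (aeval_algHom_apply σ α p).symm
    have h2 := residue γ a (c : ℚ_[2]) hc (by rw [← hc1, PadicInt.norm_def]; simp) (p.map (algebraMap ℚ ℚ_[2]))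
    rw [← h1] at h2
    have h3 := h2 (hle x)
    simpa using h3)
  exact ⟨σ, φ, hσ, fun x => by rw [hφ, hP]⟩

lemma unit_not (σx : PadicAlgCl 2) (y : ℤ_[2]) (h : σx = iotaHom (1 + 2 * y)) : ¬ ‖σx‖ < 1 := by
  rw [h, norm_iota, isUnit_aux]; norm_num

lemma even_lt (σx : PadicAlgCl 2) (y : ℤ_[2]) (h : σx = iotaHom (2 * y)) : ‖σx‖ < 1 := by
  rw [h, norm_iota]; exact (PadicInt.norm_lt_one_iff_dvd _).mpr ⟨y, by norm_num⟩

lemma main_aux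
    {K : Type*} [Field K] [NumberField K] (n : ℕ) (m : ℤ) (hn : 2 ≤ n)
    (hirr : Irreducible ((X : ℤ[X]) ^ n - C m))
    (α : K) (hroot : Polynomial.aeval α ((X : ℤ[X]) ^ n - C m) = 0)
    (hgen : Algebra.adjoin ℚ {α} = ⊤)
    (k t : ℕ) (hnrt : n = 2 ^ (k+3) * t) (ht : Odd t) (hval : 32 ∣ m - 1) :
    ∃ φ : Fin 3 → (NumberField.RingOfIntegers K →+* ZMod 2), Function.Injective φ := by
  obtain ⟨w, hw, y, hy⟩ := exists_w t ht m hval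
  obtain ⟨d, hd⟩ := hval
  have hw1 : w = 1 + 4 * y := by linear_combination hy
  have hpow : ∀ j : ℕ, ∃ z, w^j = 1 + 4 * z := by
    intro j
    obtain ⟨z, hz⟩ := (Dvd.intro y hy.symm).trans (sub_one_dvd_pow_sub_one w j)
    exact ⟨z, by linear_combination hz⟩
  have hex : ∀ j : ℕ, j ≤ 2 → ∃ (σ : K →ₐ[ℚ] PadicAlgCl 2) (φ : NumberField.RingOfIntegers K →+* ZMod 2),
      σ ((α^(2^k*t))^(2^j)) = iotaHom (- (w^t)^(2^j)) ∧
      ∀ x : NumberField.RingOfIntegers K, φ x = 0 ↔ ‖σ x‖ < 1 := by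
    intro j hj
    obtain ⟨γ, hγ⟩ := IsAlgClosed.exists_pow_nat_eq (iotaHom (-w^(2^j))) (n := 2^(k+j)) (by positivity)
    obtain ⟨z, hz⟩ := hpow (2^j)
    obtain ⟨σ, φ, hσ, hφ⟩ := exists_data n m (by omega) hirr α hroot hgen γ (by
      obtain ⟨i, hi⟩ : ∃ i, 3 = j + (i + 1) := ⟨2 - j, by omega⟩
      have : n = 2^(k+j) * (2^(i+1) * t) := by rw [hnrt, hi]; ring
      rw [this, pow_mul, hγ, ← map_pow, pow_mul, Even.neg_pow (by simp [pow_succ]), ← pow_mul, ← pow_mul,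
        ← map_intCast iotaHom, ← hw]
      congr 2
      have h8 : 2^j * 2^(i+1) = 8 := by rw [← pow_add, ← hi]; norm_num
      rw [← mul_assoc, h8]) (k+j) (-w^(2^j)) hγ (by
      have : -w^(2^j) - 1 = -(2 * (1 + 2 * z)) := by rw [hz]; ring
      rw [this, norm_neg, norm_mul, isUnit_aux, norm_two_int]; norm_num)
    refine ⟨σ, φ, ?_, hφ⟩
    rw [map_pow, map_pow, hσ]
    have : (γ^(2^k*t))^(2^j) = (γ^(2^(k+j)))^t := by rw [← pow_mul, ← pow_mul]; congr 1; ring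
    rw [this, hγ, ← map_pow, ht.neg_pow]
    congr 2
    rw [← pow_mul, ← pow_mul, mul_comm]
  set β := α^(2^k*t) with hβ
  have hβ8 : β^8 = 1 + 32 * (d : K) := by
    have h1 : α^n = (m:K) := by simpa [sub_eq_zero] using hroot
    have h2 : m = 1 + 32 * d := by linarith
    rw [hβ, ← pow_mul]
    have : 2^k*t*8 = n := by rw [hnrt]; ring
    rw [this, h1, h2]; push_cast; ring
  obtain ⟨y0, hy0⟩ : ∃ y0 : NumberField.RingOfIntegers K, (y0 : K) = (β^4+1)/2 := by
    refine ⟨⟨(β^4+1)/2, (mem_integralClosure_iff _ _).mpr ⟨X^2 - X - C (8 * d), by monicity!, ?_⟩⟩, rfl⟩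
    simp only [eval₂_sub, eval₂_mul, eval₂_pow, eval₂_X, eval₂_C]
    simp only [eq_intCast]
    push_cast
    linear_combination (1/4) * hβ8
  obtain ⟨z0, hz0⟩ : ∃ z0 : NumberField.RingOfIntegers K, (z0 : K) = (β^2+1)/2 * ((β^4+1)/2) := by
    refine ⟨⟨(β^2+1)/2 * ((β^4+1)/2), (mem_integralClosure_iff _ _).mpr
      ⟨X^4 - X^3 - C (12 * d) * X^2 - C (64 * d^2) * X - C (128 * d^3), by monicity!, ?_⟩⟩, rfl⟩
    set z := (β^2+1)/2 * ((β^4+1)/2) with hz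
    have h1 : β^2 * z = z + 8 * d := by rw [hz]; linear_combination (1/4) * hβ8
    have h2 : 4 * z = (β^2)^3 + (β^2)^2 + β^2 + 1 := by rw [hz]; ring
    have h3 : 4 * z^4 = (β^2*z)^3 + (β^2*z)^2*z + (β^2*z)*z^2 + z^3 := by linear_combination z^3 * h2
    rw [h1] at h3
    simp only [eval₂_sub, eval₂_mul, eval₂_pow, eval₂_X, eval₂_C]
    simp only [eq_intCast]
    push_cast
    clear_value z
    linear_combination (1/4) * h3
  obtain ⟨σ0, φ0, h0, hφ0⟩ := hex 0 (by norm_num)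
  obtain ⟨σ1, φ1, h1, hφ1⟩ := hex 1 (by norm_num)
  obtain ⟨σ2, φ2, h2, hφ2⟩ := hex 2 (by norm_num)
  obtain ⟨b, hb⟩ := hpow (t * 2)
  obtain ⟨e, he⟩ := hpow (t * 4)
  rw [pow_mul] at hb he
  norm_num at h0 h1 h2
  have i2 : iotaHom 2 = 2 := map_ofNat iotaHom 2
  have i4 : iotaHom 4 = 4 := map_ofNat iotaHom 4
  have s0 : σ0 2 = 2 := map_ofNat σ0 2
  have s1 : σ1 2 = 2 := map_ofNat σ1 2
  have s2 : σ2 2 = 2 := map_ofNat σ2 2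
  have e0 : σ0 y0 = iotaHom (1 + 2 * e) := by
    have : (iotaHom w ^ t)^4 = 1 + 4 * iotaHom e := by simpa [i4] using congrArg iotaHom he
    rw [hy0]; simp [h0, i2, s0]; linear_combination (1/2) * this
  have e1 : σ1 y0 = iotaHom (1 + 2 * e) := by
    have : (iotaHom w ^ t)^4 = 1 + 4 * iotaHom e := by simpa [i4] using congrArg iotaHom he
    have h4 : σ1 β ^ 4 = (iotaHom w ^ t)^4 := by
      linear_combination (σ1 β ^ 2 - (iotaHom w ^ t)^2) * h1
    rw [hy0]; simp [h4, i2, s1]; linear_combination (1/2) * this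
  have e2 : σ2 y0 = iotaHom (2 * (-e)) := by
    have : (iotaHom w ^ t)^4 = 1 + 4 * iotaHom e := by simpa [i4] using congrArg iotaHom he
    rw [hy0]; simp [h2, i2, s2]; linear_combination (-1/2) * this
  have f0 : σ0 z0 = iotaHom (1 + 2 * (b + e + 2 * b * e)) := by
    have hb' : (iotaHom w ^ t)^2 = 1 + 4 * iotaHom b := by simpa [i4] using congrArg iotaHom hb
    rw [hz0, map_mul, ← hy0, e0]
    simp [h0, i2, s0]; rw [hb']; ring
  have f1 : σ1 z0 = iotaHom (2 * (-b * (1 + 2 * e))) := by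
    have hb' : (iotaHom w ^ t)^2 = 1 + 4 * iotaHom b := by simpa [i4] using congrArg iotaHom hb
    rw [hz0, map_mul, ← hy0, e1]
    simp [h1, i2, s1]; rw [hb']; ring
  have a0 := mt (hφ0 y0).mp (unit_not _ _ e0)
  have a1 := mt (hφ1 y0).mp (unit_not _ _ e1)
  have a2 := (hφ2 y0).mpr (even_lt _ _ e2)
  have b0 := mt (hφ0 z0).mp (unit_not _ _ f0)
  have b1 := (hφ1 z0).mpr (even_lt _ _ f1)
  have n01 : φ0 ≠ φ1 := by rintro rfl; exact b0 b1
  have n02 : φ0 ≠ φ2 := by rintro rfl; exact a0 a2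
  have n12 : φ1 ≠ φ2 := by rintro rfl; exact a1 a2
  refine ⟨![φ0, φ1, φ2], ?_⟩
  intro i j hij
  fin_cases i <;> fin_cases j <;> simp at hij ⊢
  · exact n01 hij
  · exact n02 hij
  · exact n01 hij.symm
  · exact n12 hij
  · exact n02 hij.symm
  · exact n12 hij.symm



/-- Let `f(x) = x^n - m` be monic irreducible, `n ≥ 2`, `n = 2^r·t` with `t` odd, and
`K = ℚ(α)` for a root `α` of `f`. If `m` is odd, `r ≥ 3`, and `ν_2(m-1) ≥ 5`, then `2`
divides `(𝓞_K : ℤ[θ])` for every generator `θ ∈ 𝓞_K` of `K`; in particular `K` is not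
monogenic. -/
theorem not_monogenic_case5
    {K : Type*} [Field K] [NumberField K] (n : ℕ) (m : ℤ) (hn : 2 ≤ n)
    (hirr : Irreducible ((X : ℤ[X]) ^ n - C m))
    (α : K) (hroot : Polynomial.aeval α ((X : ℤ[X]) ^ n - C m) = 0)
    (hgen : Algebra.adjoin ℚ {α} = ⊤)
    (r t : ℕ) (hnrt : n = 2 ^ r * t) (ht : Odd t)
    (hm : Odd m) (hr : r ≥ 3) (hval : padicValInt 2 (m - 1) ≥ 5) :
    (∀ θ : NumberField.RingOfIntegers K, Algebra.adjoin ℚ {(θ : K)} = ⊤ →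
        2 ∣ (Subalgebra.toSubmodule (Algebra.adjoin ℤ {θ})).toAddSubgroup.index) ∧
      ¬ ∃ θ : NumberField.RingOfIntegers K, Algebra.adjoin ℤ {θ} = ⊤ := by
  obtain ⟨k, rfl⟩ := Nat.exists_eq_add_of_le' hr
  have h32 : (32 : ℤ) ∣ m - 1 := by
    have := (padicValInt_dvd_iff (p := 2) 5 (m - 1)).mpr (Or.inr hval)
    norm_num at this; exact this
  obtain ⟨φ, hφ⟩ := main_aux n m hn hirr α hroot hgen k t hnrt ht h32
  refine ⟨fun θ _ => two_dvd_index_aux φ hφ θ, ?_⟩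
  rintro ⟨θ, hθ⟩
  have h := two_dvd_index_aux φ hφ θ
  have h1 : (Subalgebra.toSubmodule (Algebra.adjoin ℤ {θ})).toAddSubgroup = ⊤ := by
    rw [hθ]; rfl
  rw [h1, AddSubgroup.index_top] at h
  norm_num at h
end

section
/- The polynomial f(x) = x^{48} − 528 is irreducible over ℚ, and the pure number field K = ℚ(α), where α is a complex root of f, is not monogenic. -/
open Polynomial NumberField

set_option linter.unusedSectionVars false
set_option linter.unusedSimpArgs false
namespace Ex15
section
variable {F : Type*} [Field F] [CharZero F]

def fw (d : F) : F := (1 + (d^2/2)^2)/2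
def fa (d : F) : F := fw d * (1 + d^2/2)/2
def fb (d : F) : F := (1 - fw d)^2/2 + (1 - fw d) * d * (1 - d^2/2)/4

lemma eg {d : F} (h : d^8 = 528) : (d^2/2)^4 = 33 := by
  field_simp; linear_combination h
lemma ew {d : F} (h : d^8 = 528) : fw d * fw d = fw d + 8 := by
  have := eg h
  unfold fw
  linear_combination (1/4) * this
lemma ea {d : F} (h : d^8 = 528) : fa d * fa d = fw d * fa d + 4 * fw d := by
  have h1 := ew h
  have h2 : (d^2/2)^2 = 2 * fw d - 1 := by unfold fw; ring
  unfold fa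
  generalize fw d = w at *
  generalize d^2/2 = g at *
  linear_combination (w^2/4) * h2 + (w/2) * h1
lemma eb {d : F} (h : d^8 = 528) :
    fb d * fb d = (1 - fw d)^2 * fb d + 2 * (1 - fw d) * (fw d - d^2/2) := by
  have h1 := ew h
  have h2 : (d^2/2)^2 = 2 * fw d - 1 := by unfold fw; ring
  have h3 : d^2 = 2 * (d^2/2) := by ring
  unfold fb
  generalize fw d = w at *
  generalize d^2/2 = g at *
  have h4 : (d * (1-g))^2 = 4 * g * w - 4 * (2*w-1) := by
    linear_combination (1-g)^2 * h3 + (2*g - 4) * h2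
  linear_combination ((1-w)^2/16) * h4 + ((1-w) * (w - g)/4) * h1

lemma ig {d : F} (h : d^8 = 528) : IsIntegral ℤ (d^2/2) := by
  refine ⟨X^4 - C 33, monic_X_pow_sub_C _ (by norm_num), ?_⟩
  simp [eval₂_sub, eg h]
lemma iquad {x p q : F} (hp : IsIntegral ℤ p) (hq : IsIntegral ℤ q) (h : x * x = p * x + q) :
    IsIntegral ℤ x := by
  let p' : 𝓞 F := ⟨p, hp⟩
  let q' : 𝓞 F := ⟨q, hq⟩
  have : IsIntegral (𝓞 F) x := by
    refine ⟨X^2 - (C p' * X + C q'), ?_, ?_⟩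
    · apply monic_X_pow_sub
      compute_degree
      norm_num
    · have hp' : algebraMap (𝓞 F) F p' = p := rfl
      have hq' : algebraMap (𝓞 F) F q' = q := rfl
      simp only [eval₂_sub, eval₂_add, eval₂_mul, eval₂_pow, eval₂_X, eval₂_C, hp', hq']
      linear_combination h
  exact isIntegral_trans (R := ℤ) x this
lemma inat (n : ℕ) [n.AtLeastTwo] : IsIntegral ℤ (OfNat.ofNat n : F) := by
  have := isIntegral_algebraMap (R := ℤ) (A := F) (x := (OfNat.ofNat n : ℤ))
  simpa using this
lemma iw {d : F} (h : d^8 = 528) : IsIntegral ℤ (fw d) :=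
  iquad (p := 1) isIntegral_one (inat 8) (by rw [ew h]; ring)
lemma ia {d : F} (h : d^8 = 528) : IsIntegral ℤ (fa d) :=
  iquad (iw h) ((inat 4).mul (iw h)) (ea h)
lemma ib {d : F} (h : d^8 = 528) : IsIntegral ℤ (fb d) :=
  iquad ((isIntegral_one.sub (iw h)).pow 2)
    (((inat 2).mul (isIntegral_one.sub (iw h))).mul ((iw h).sub (ig h))) (eb h)

def W (d : F) (h : d^8 = 528) : 𝓞 F := ⟨fw d, iw h⟩
def A (d : F) (h : d^8 = 528) : 𝓞 F := ⟨fa d, ia h⟩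
def B (d : F) (h : d^8 = 528) : 𝓞 F := ⟨fb d, ib h⟩
def G (d : F) (h : d^8 = 528) : 𝓞 F := ⟨d^2/2, ig h⟩

lemma cW (d : F) (h : d^8 = 528) : ((W d h : 𝓞 F) : F) = fw d := rfl
lemma cA (d : F) (h : d^8 = 528) : ((A d h : 𝓞 F) : F) = fa d := rfl
lemma cB (d : F) (h : d^8 = 528) : ((B d h : 𝓞 F) : F) = fb d := rfl
lemma cG (d : F) (h : d^8 = 528) : ((G d h : 𝓞 F) : F) = d^2/2 := rfl

variable {z : F}

lemma zd (hz : z^4 = -1) {d : F} (h : d^8 = 528) : (z*d)^8 = 528 := by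
  linear_combination (z^8) * h + 528 * (z^4-1) * hz
lemma zzd (hz : z^4 = -1) {d : F} (h : d^8 = 528) : (z^2*d)^8 = 528 := by
  linear_combination (z^16) * h + 528 * (z^12-z^8+z^4-1) * hz
lemma nd {d : F} (h : d^8 = 528) : (-d)^8 = 528 := by
  linear_combination h

lemma sW (hz : z^4 = -1) {d : F} (h : d^8 = 528) : W d h + W (z*d) (zd hz h) = 1 := by
  apply RingOfIntegers.ext
  simp only [map_add, map_one, cW, fw]
  linear_combination (d^4/8) * hz
lemma pW {d : F} (h : d^8 = 528) : W d h * (1 - W d h) = -8 := by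
  apply RingOfIntegers.ext
  simp only [map_mul, map_sub, map_one, map_neg, map_ofNat, cW]
  linear_combination -ew h
lemma wW (hz : z^4 = -1) {d : F} (h : d^8 = 528) : W (z^2*d) (zzd hz h) = W d h := by
  apply RingOfIntegers.ext
  simp only [cW, fw]
  linear_combination (d^4/8) * (z^4-1) * hz
lemma nW {d : F} (h : d^8 = 528) : W (-d) (nd h) = W d h := by
  apply RingOfIntegers.ext
  simp only [cW, fw]
  ring
lemma sA {d : F} (h : d^8 = 528) : A d h * (W d h - A d h) = - 4 * W d h := by
  apply RingOfIntegers.ext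
  simp only [map_mul, map_sub, map_one, map_neg, map_ofNat, cW, cA]
  linear_combination -ea h
lemma sB {d : F} (h : d^8 = 528) : B d h + B (-d) (nd h) = (1 - W d h)^2 := by
  apply RingOfIntegers.ext
  simp only [map_add, map_pow, map_sub, map_one, cW, cB, fb, fw]
  ring
lemma pB {d : F} (h : d^8 = 528) :
   B d h * ((1 - W d h)^2 - B d h) = - 2 * ((1 - W d h) * (W d h - G d h)) := by
  apply RingOfIntegers.ext
  simp only [map_mul, map_sub, map_one, map_neg, map_pow, map_ofNat, cW, cB, cG]
  linear_combination -eb h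
lemma sA' (hz : z^4 = -1) {d : F} (h : d^8 = 528) : A d h + A (z^2*d) (zzd hz h) = W d h := by
  apply RingOfIntegers.ext
  simp only [map_add, cW, cA, fa]
  have := congrArg (fun x : 𝓞 F => (x : F)) (wW hz h)
  simp only [cW] at this
  rw [this]
  linear_combination (fw d * d^2/4) * hz

lemma fourD [IsAlgClosed F] (P : Ideal (𝓞 F)) (hP : P.IsPrime) (h2 : (2 : 𝓞 F) ∈ P) :
    ∃ (d₁ d₂ d₃ d₄ : F) (h₁ : d₁^8 = 528) (h₂ : d₂^8 = 528) (h₃ : d₃^8 = 528) (h₄ : d₄^8 = 528),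
      (W d₁ h₁ ∉ P ∧ A d₁ h₁ ∉ P) ∧ (W d₂ h₂ ∉ P ∧ A d₂ h₂ ∈ P) ∧
      (W d₃ h₃ ∈ P ∧ B d₃ h₃ ∉ P) ∧ (W d₄ h₄ ∈ P ∧ B d₄ h₄ ∈ P) := by
  obtain ⟨z, hz⟩ := IsAlgClosed.exists_pow_nat_eq (-1 : F) (n := 4) (by norm_num)
  obtain ⟨d, hd⟩ := IsAlgClosed.exists_pow_nat_eq (528 : F) (n := 8) (by norm_num)
  have one : (1 : 𝓞 F) ∉ P := fun h => hP.ne_top ((Ideal.eq_top_iff_one _).2 h)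
  have dW : ∀ (e : F) (he : e^8 = 528), W e he ∈ P ∨ 1 - W e he ∈ P := fun e he => by
    apply hP.mem_or_mem
    rw [pW he, show (-8 : 𝓞 F) = -4 * 2 by norm_num]
    exact P.mul_mem_left _ h2
  have dA : ∀ (e : F) (he : e^8 = 528), A e he ∈ P ∨ W e he - A e he ∈ P := fun e he => by
    apply hP.mem_or_mem
    rw [sA he, show (-4 * W e he : 𝓞 F) = (-2 * W e he) * 2 by ring]
    exact P.mul_mem_left _ h2
  have dB : ∀ (e : F) (he : e^8 = 528), B e he ∈ P ∨ (1 - W e he)^2 - B e he ∈ P := fun e he => by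
    apply hP.mem_or_mem
    rw [pB he, mul_comm, mul_neg]
    exact P.neg_mem (P.mul_mem_left _ h2)
  have good : ∃ (e : F) (he : e^8 = 528), W e he ∉ P := by
    by_contra! H
    exact one (sW hz hd ▸ P.add_mem (H _ _) (H _ _))
  obtain ⟨e, he, hW⟩ := good
  have bad : W (z*e) (zd hz he) ∈ P := by
    have := (dW e he).resolve_left hW
    rwa [← sW hz he, add_sub_cancel_left] at this
  have hW2 := hW
  rw [← wW hz he] at hW2
  have X : ∃ (d₁ d₂ : F) (h₁ : d₁^8 = 528) (h₂ : d₂^8 = 528),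
      (W d₁ h₁ ∉ P ∧ A d₁ h₁ ∉ P) ∧ (W d₂ h₂ ∉ P ∧ A d₂ h₂ ∈ P) := by
    have hs := sA' hz he
    rcases dA e he with h | h
    · refine ⟨_, e, _, he, ⟨hW2, fun h' => hW (hs ▸ P.add_mem h h')⟩, hW, h⟩
    · refine ⟨e, _, he, _, ⟨hW, fun h' => hW ?_⟩, hW2, ?_⟩
      · simpa using P.add_mem h h'
      · rwa [← hs, add_sub_cancel_left] at h
  have Y : ∃ (d₁ d₂ : F) (h₁ : d₁^8 = 528) (h₂ : d₂^8 = 528),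
      (W d₁ h₁ ∈ P ∧ B d₁ h₁ ∉ P) ∧ (W d₂ h₂ ∈ P ∧ B d₂ h₂ ∈ P) := by
    have key : (1 - W (z*e) (zd hz he))^2 ∉ P := fun h => one (by
      have := P.add_mem (hP.mem_of_pow_mem _ h) bad
      simpa using this)
    generalize_proofs at *
    revert bad key
    generalize z * e = e'  at *
    intro bad key
    have hs := sB (d := e') ‹_›
    have bad2 := bad
    rw [← nW] at bad2
    rcases dB e' ‹_› with h | h
    · exact ⟨_, e', _, ‹_›, ⟨bad2, fun h' => key (hs ▸ P.add_mem h h')⟩, bad, h⟩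
    · refine ⟨e', _, ‹_›, _, ⟨bad, fun h' => key ?_⟩, bad2, ?_⟩
      · simpa using P.add_mem h h'
      · rwa [← hs, add_sub_cancel_left] at h
  obtain ⟨a, b, c, d, e⟩ := X
  obtain ⟨a', b', c', d', e'⟩ := Y
  exact ⟨a, b, a', b', c, d, c', d', e.1, e.2, e'.1, e'.2⟩
end

lemma exP : ∃ P : Ideal (𝓞 (AlgebraicClosure ℚ)), P.IsPrime ∧ (2 : 𝓞 (AlgebraicClosure ℚ)) ∈ P := by
  have hnu : ¬ IsUnit (2 : 𝓞 (AlgebraicClosure ℚ)) := by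
    intro hu
    obtain ⟨y, hy⟩ := hu.exists_right_inv
    have hy' : (2 : AlgebraicClosure ℚ) * (y : AlgebraicClosure ℚ) = 1 := by
      have := congrArg (fun x : 𝓞 (AlgebraicClosure ℚ) => (x : AlgebraicClosure ℚ)) hy
      simp only [map_mul, map_one, map_ofNat] at this
      exact this
    have h1 : (y : AlgebraicClosure ℚ) = algebraMap ℚ _ (1/2) := by
      rw [map_div₀, map_one, map_ofNat]
      field_simp
      linear_combination hy'
    have h3 : IsIntegral ℤ (1/2 : ℚ) := by
      have := y.2
      rw [show y.1 = _ from h1] at this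
      exact (isIntegral_algebraMap_iff (algebraMap ℚ (AlgebraicClosure ℚ)).injective).1 this
    obtain ⟨n, hn⟩ := IsIntegrallyClosed.isIntegral_iff.1 h3
    have : (2 * n : ℤ) = 1 := by
      have : (2 * n : ℚ) = 1 := by
        simp at hn; rw [hn]; norm_num
      exact_mod_cast this
    omega
  obtain ⟨P, hP, h⟩ := exists_max_ideal_of_mem_nonunits hnu
  exact ⟨P, hP.isPrime, h⟩

section
variable {K : Type*} [Field K] [NumberField K]

lemma irr : Irreducible (((X : ℤ[X]) ^ 48 - C 528).map (Int.castRingHom ℚ)) := by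
  have hm : ((X : ℤ[X]) ^ 48 - C 528).Monic := monic_X_pow_sub_C _ (by norm_num)
  rw [← algebraMap_int_eq, ← hm.irreducible_iff_irreducible_map_fraction_map (K := ℚ)]
  have hp : Prime (3 : ℤ) := Int.prime_three
  have hd : ((X : ℤ[X]) ^ 48 - C 528).natDegree = 48 := natDegree_X_pow_sub_C
  refine IsEisensteinAt.irreducible (𝓟 := Ideal.span {3}) ⟨?_, ?_, ?_⟩
    ((Ideal.span_singleton_prime (by norm_num)).2 hp) hm.isPrimitive (by rw [hd]; norm_num)
  · rw [hm.leadingCoeff, Ideal.mem_span_singleton]; norm_num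
  · intro n hn
    rw [hd] at hn
    rw [coeff_sub, coeff_X_pow, coeff_C, if_neg (by omega), Ideal.mem_span_singleton]
    split_ifs <;> norm_num
  · rw [coeff_sub, coeff_X_pow, coeff_C, Ideal.span_singleton_pow, Ideal.mem_span_singleton]
    norm_num

lemma mp (α : K) (h : α^48 = 528) :
    minpoly ℚ α = (((X : ℤ[X]) ^ 48 - C 528).map (Int.castRingHom ℚ)) := by
  symm
  refine minpoly.eq_of_irreducible_of_monic irr ?_ ?_
  · simp only [Polynomial.map_sub, Polynomial.map_pow, map_X, map_C, map_sub, map_pow, aeval_X, aeval_C, h]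
    simp [-eq_intCast, map_ofNat]
  · exact (monic_X_pow_sub_C _ (by norm_num)).map _

lemma exPB (α : K) (hgen : Algebra.adjoin ℚ {α} = ⊤) : ∃ pb : PowerBasis ℚ K, pb.gen = α :=
  ⟨(PowerBasis.ofAdjoinEqTop (Algebra.IsIntegral.isIntegral α) hgen), by simp⟩

lemma exHom (α : K) (h : α^48 = 528) (hgen : Algebra.adjoin ℚ {α} = ⊤) 
    (d : AlgebraicClosure ℚ) (hd : d^8 = 528) :
    ∃ φ : K →+* AlgebraicClosure ℚ, φ (α^6) = d := by
  obtain ⟨pb, rfl⟩ := exPB α hgen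
  obtain ⟨a, ha⟩ := IsAlgClosed.exists_pow_nat_eq d (n := 6) (by norm_num)
  refine ⟨(pb.lift a ?_).toRingHom, ?_⟩
  · rw [mp _ h]
    have : a^48 = 528 := by rw [← hd, ← ha]; ring
    simp only [Polynomial.map_sub, Polynomial.map_pow, map_X, map_C, map_sub, map_pow, aeval_X, aeval_C, this]
    simp [-eq_intCast, map_ofNat]
  · simp [ha]

lemma exQ (α : K) (h : α^48 = 528) (hgen : Algebra.adjoin ℚ {α} = ⊤) (h' : (α^6)^8 = 528)
    (P : Ideal (𝓞 (AlgebraicClosure ℚ))) (hP : P.IsPrime) (h2 : (2 : 𝓞 (AlgebraicClosure ℚ)) ∈ P)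
    (d : AlgebraicClosure ℚ) (hd : d^8 = 528) :
    ∃ Q : Ideal (𝓞 K), Q.IsPrime ∧ 2 ∈ Q ∧ (W (α^6) h' ∈ Q ↔ W d hd ∈ P) ∧
      (A (α^6) h' ∈ Q ↔ A d hd ∈ P) ∧ (B (α^6) h' ∈ Q ↔ B d hd ∈ P) := by
  obtain ⟨φ, rfl⟩ := exHom α h hgen d hd
  refine ⟨P.comap (RingOfIntegers.mapRingHom φ), hP.comap _, ?_, ?_, ?_, ?_⟩
  · rw [Ideal.mem_comap, map_ofNat]; exact h2
  all_goals
    rw [Ideal.mem_comap]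
    apply iff_of_eq
    congr 1
    apply RingOfIntegers.ext
    rw [RingOfIntegers.mapRingHom_apply]
    simp [cW, cA, cB, fw, fa, fb, map_ofNat]

lemma normα (α : 𝓞 K) (h : (α : K)^48 = 528) (hgen : Algebra.adjoin ℚ {(α : K)} = ⊤) :
    Ideal.absNorm (Ideal.span {α}) = 528 := by
  obtain ⟨pb, hpb⟩ := exPB _ hgen
  have : (Algebra.norm ℤ α : ℚ) = -528 := by
    rw [Algebra.coe_norm_int, ← hpb, Algebra.PowerBasis.norm_gen_eq_coeff_zero_minpoly, ← pb.natDegree_minpoly, hpb, mp _ h,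
      (monic_X_pow_sub_C (528 : ℤ) (n := 48) (by norm_num)).natDegree_map, natDegree_X_pow_sub_C]
    simp
    norm_num
  have : Algebra.norm ℤ α = -528 := by exact_mod_cast this
  rw [Ideal.absNorm_span_singleton, this]; rfl

lemma norm2 (Q : Ideal (𝓞 K)) (hQ : Q.IsPrime) (h2 : (2 : 𝓞 K) ∈ Q) :
    ∃ k, 1 ≤ k ∧ Ideal.absNorm Q = 2^k := by
  have h := Ideal.absNorm_dvd_absNorm_of_le ((Ideal.span_singleton_le_iff_mem _).2 h2)
  rw [Ideal.absNorm_span_singleton, show (2 : 𝓞 K) = algebraMap ℤ _ 2 by simp,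
    Algebra.norm_algebraMap, Int.natAbs_pow] at h
  obtain ⟨k, -, hk⟩ := (Nat.dvd_prime_pow Nat.prime_two).1 h
  refine ⟨k, ?_, hk⟩
  rcases k with _ | k
  · exact absurd (Ideal.absNorm_eq_one_iff.1 (by simpa using hk)) hQ.ne_top
  · omega

lemma cop (P Q : Ideal (𝓞 K)) (hP : P.IsPrime) (hQ : Q.IsPrime) (hP2 : (2 : 𝓞 K) ∈ P) 
    (hQ2 : (2 : 𝓞 K) ∈ Q) (h : P ≠ Q) : IsCoprime P Q := by
  have h0 : ∀ R : Ideal (𝓞 K), (2 : 𝓞 K) ∈ R → R ≠ ⊥ := by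
    rintro R h rfl
    simp at h
  have mP := hP.isMaximal (h0 P hP2)
  have mQ := hQ.isMaximal (h0 Q hQ2)
  rw [Ideal.isCoprime_iff_sup_eq]
  exact mP.coprime_of_ne mQ h

lemma two_elts (Q : Ideal (𝓞 K)) (h : Ideal.absNorm Q = 2) (x : 𝓞 K) : x ∈ Q ∨ x - 1 ∈ Q := by
  rw [Ideal.absNorm_apply, Submodule.cardQuot_apply] at h
  obtain ⟨y, -, hy⟩ := (Nat.card_eq_two_iff' (0 : 𝓞 K ⧸ Q)).1 h
  by_contra! H
  have hx := hy (Ideal.Quotient.mk Q x) (by simpa [Ideal.Quotient.eq_zero_iff_mem] using H.1)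
  have h1 := hy 1 (fun h1 => H.1 (by
    have : (1 : 𝓞 K) ∈ Q := by rw [← Ideal.Quotient.eq_zero_iff_mem]; simpa using h1
    simpa using Q.mul_mem_left x this))
  apply H.2
  rw [← Ideal.Quotient.eq_zero_iff_mem, map_sub, hx, map_one, h1, sub_self]

lemma same (θ : 𝓞 K) (hθ : Algebra.adjoin ℤ {θ} = ⊤) (P Q : Ideal (𝓞 K)) (hP : P.IsPrime)
    (hQ : Q.IsPrime) (hP2 : (2 : 𝓞 K) ∈ P) (hQ2 : (2 : 𝓞 K) ∈ Q) (c : ℤ)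
    (h1 : θ - c ∈ P) (h2 : θ - c ∈ Q) : P = Q := by
  have key : ∀ (R : Ideal (𝓞 K)), R.IsPrime → (2 : 𝓞 K) ∈ R → θ - c ∈ R → ∀ p : ℤ[X],
      aeval θ p ∈ R ↔ (2 : ℤ) ∣ p.eval c := by
    intro R hR hR2 hc p
    have e : aeval θ p - (p.eval c : ℤ) ∈ R := by
      have := (Polynomial.sub_dvd_eval_sub θ (c : 𝓞 K) (p.map (algebraMap ℤ (𝓞 K))))
      refine R.mem_of_dvd ?_ hc
      have e2 : ((p.eval c : ℤ) : 𝓞 K) = (p.map (algebraMap ℤ (𝓞 K))).eval (c : 𝓞 K) := by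
        rw [← eq_intCast (algebraMap ℤ (𝓞 K)) c, eval_map_algebraMap, aeval_algebraMap_apply]
        simp
      rwa [e2, ← eval_map_algebraMap]
    have e3 : aeval θ p ∈ R ↔ ((p.eval c : ℤ) : 𝓞 K) ∈ R := by
      constructor
      · intro h; simpa using R.sub_mem h e
      · intro h; simpa using R.add_mem e h
    rw [e3]
    generalize p.eval c = n
    constructor
    · intro h
      by_contra hn
      obtain ⟨m, hm⟩ := Int.odd_iff.2 (show n % 2 = 1 by omega)
      apply hR.ne_top
      rw [Ideal.eq_top_iff_one]
      have := R.sub_mem h (R.mul_mem_right (m : 𝓞 K) hR2)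
      rw [hm] at this
      simpa using this
    · rintro ⟨m, rfl⟩
      push_cast
      exact R.mul_mem_right _ hR2
  ext x
  have hx : x ∈ Algebra.adjoin ℤ {θ} := hθ ▸ Algebra.mem_top
  rw [Algebra.adjoin_singleton_eq_range_aeval] at hx
  obtain ⟨p, rfl⟩ := hx
  exact (key P hP hP2 h1 p).trans (key Q hQ hQ2 h2 p).symm

end
end Ex15

theorem example_15
    {K : Type*} [Field K] [NumberField K]
    (α : K)
    (hroot : Polynomial.aeval α ((X : ℤ[X]) ^ 48 - C 528) = 0)
    (hgen : Algebra.adjoin ℚ {α} = ⊤) :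
    Irreducible (((X : ℤ[X]) ^ 48 - C 528).map (Int.castRingHom ℚ)) ∧
      ¬ ∃ θ : NumberField.RingOfIntegers K, Algebra.adjoin ℤ {θ} = ⊤ := by
  refine ⟨Ex15.irr, ?_⟩
  rintro ⟨θ, hθ⟩
  have h : α^48 = 528 := by
    rw [map_sub, map_pow, aeval_X, aeval_C, sub_eq_zero] at hroot
    rw [hroot, map_ofNat]
  have h' : (α^6)^8 = 528 := by rw [← h]; ring
  have hαi : IsIntegral ℤ α := ⟨X^48 - C 528, monic_X_pow_sub_C _ (by norm_num), hroot⟩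
  let a : 𝓞 K := ⟨α, hαi⟩
  have ha : a^48 = 528 := by
    apply RingOfIntegers.ext
    simp only [map_pow, map_ofNat]
    exact h
  have hN : Ideal.absNorm (Ideal.span {a}) = 528 := Ex15.normα a h hgen
  obtain ⟨P, hP, hP2⟩ := Ex15.exP
  obtain ⟨d₁, d₂, d₃, d₄, h₁, h₂, h₃, h₄, s₁, s₂, s₃, s₄⟩ := Ex15.fourD P hP hP2
  obtain ⟨Q₁, p₁, t₁, w₁, a₁, b₁⟩ := Ex15.exQ α h hgen h' P hP hP2 d₁ h₁
  obtain ⟨Q₂, p₂, t₂, w₂, a₂, b₂⟩ := Ex15.exQ α h hgen h' P hP hP2 d₂ h₂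
  obtain ⟨Q₃, p₃, t₃, w₃, a₃, b₃⟩ := Ex15.exQ α h hgen h' P hP hP2 d₃ h₃
  obtain ⟨Q₄, p₄, t₄, w₄, a₄, b₄⟩ := Ex15.exQ α h hgen h' P hP hP2 d₄ h₄
  have n12 : Q₁ ≠ Q₂ := fun e => s₁.2 (a₁.1 (e ▸ a₂.2 s₂.2))
  have n13 : Q₁ ≠ Q₃ := fun e => s₁.1 (w₁.1 (e ▸ w₃.2 s₃.1))
  have n14 : Q₁ ≠ Q₄ := fun e => s₁.1 (w₁.1 (e ▸ w₄.2 s₄.1))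
  have n23 : Q₂ ≠ Q₃ := fun e => s₂.1 (w₂.1 (e ▸ w₃.2 s₃.1))
  have n24 : Q₂ ≠ Q₄ := fun e => s₂.1 (w₂.1 (e ▸ w₄.2 s₄.1))
  have n34 : Q₃ ≠ Q₄ := fun e => s₃.2 (b₃.1 (e ▸ b₄.2 s₄.2))
  have dv : ∀ Q : Ideal (𝓞 K), Q.IsPrime → (2 : 𝓞 K) ∈ Q → Q ∣ Ideal.span {a} := by
    intro Q hQ h2
    rw [Ideal.dvd_span_singleton]
    apply hQ.mem_of_pow_mem 48
    rw [ha, show (528 : 𝓞 K) = 264 * 2 by norm_num]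
    exact Q.mul_mem_left _ h2
  have c12 := Ex15.cop _ _ p₁ p₂ t₁ t₂ n12
  have c13 := Ex15.cop _ _ p₁ p₃ t₁ t₃ n13
  have c14 := Ex15.cop _ _ p₁ p₄ t₁ t₄ n14
  have c23 := Ex15.cop _ _ p₂ p₃ t₂ t₃ n23
  have c24 := Ex15.cop _ _ p₂ p₄ t₂ t₄ n24
  have c34 := Ex15.cop _ _ p₃ p₄ t₃ t₄ n34
  have D : Q₁ * Q₂ * Q₃ * Q₄ ∣ Ideal.span {a} :=
    ((c14.mul_left c24).mul_left c34).mul_dvd ((c13.mul_left c23).mul_dvd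
      (c12.mul_dvd (dv _ p₁ t₁) (dv _ p₂ t₂)) (dv _ p₃ t₃)) (dv _ p₄ t₄)
  have D2 := map_dvd Ideal.absNorm D
  obtain ⟨k₁, l₁, e₁⟩ := Ex15.norm2 Q₁ p₁ t₁
  obtain ⟨k₂, l₂, e₂⟩ := Ex15.norm2 Q₂ p₂ t₂
  obtain ⟨k₃, l₃, e₃⟩ := Ex15.norm2 Q₃ p₃ t₃
  obtain ⟨k₄, l₄, e₄⟩ := Ex15.norm2 Q₄ p₄ t₄
  rw [hN, map_mul, map_mul, map_mul, e₁, e₂, e₃, e₄, ← pow_add, ← pow_add, ← pow_add] at D2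
  have le : k₁ + k₂ + k₃ + k₄ ≤ 4 := by
    by_contra! hlt
    have : 2^5 ∣ 528 := (pow_dvd_pow 2 hlt).trans D2
    norm_num at this
  obtain rfl : k₁ = 1 := by omega
  obtain rfl : k₂ = 1 := by omega
  obtain rfl : k₃ = 1 := by omega
  have S := fun Q R hQ hR tQ tR => Ex15.same θ hθ Q R hQ hR tQ tR 0
  have T := fun Q R hQ hR tQ tR => Ex15.same θ hθ Q R hQ hR tQ tR 1
  simp only [Int.cast_zero, sub_zero, Int.cast_one] at S T
  rcases Ex15.two_elts Q₁ (by simpa using e₁) θ with u₁ | u₁ <;>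
  rcases Ex15.two_elts Q₂ (by simpa using e₂) θ with u₂ | u₂ <;>
  rcases Ex15.two_elts Q₃ (by simpa using e₃) θ with u₃ | u₃ <;>
  first
  | exact n12 (S _ _ p₁ p₂ t₁ t₂ u₁ u₂)
  | exact n12 (T _ _ p₁ p₂ t₁ t₂ u₁ u₂)
  | exact n13 (S _ _ p₁ p₃ t₁ t₃ u₁ u₃)
  | exact n13 (T _ _ p₁ p₃ t₁ t₃ u₁ u₃)
  | exact n23 (S _ _ p₂ p₃ t₂ t₃ u₂ u₃)
  | exact n23 (T _ _ p₂ p₃ t₂ t₃ u₂ u₃)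
end

section
/- The polynomial f(x) = x^{135} + 2214 is irreducible over ℚ, and the pure number field K = ℚ(α), where α is a complex root of f, is not monogenic. -/
open Polynomial

namespace Ex16

lemma eis (n : ℕ) (hn : 0 < n) (p : ℤ) (hp : Prime p) (h1 : p ∣ 2214) (h2 : ¬ p ^ 2 ∣ 2214) :
    ((X : ℤ[X]) ^ n + C 2214).IsEisensteinAt (Ideal.span {p}) := by
  have hdeg : ((X : ℤ[X]) ^ n + C 2214).natDegree = n := natDegree_X_pow_add_C
  have hmon : ((X : ℤ[X]) ^ n + C 2214).Monic := monic_X_pow_add_C _ hn.ne'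
  refine ⟨?_, ?_, ?_⟩
  · rw [hmon.leadingCoeff, Ideal.mem_span_singleton]
    exact fun h => hp.not_isUnit (isUnit_of_dvd_one h)
  · intro k hk
    rw [hdeg] at hk
    rw [Ideal.mem_span_singleton, coeff_add, coeff_X_pow, if_neg hk.ne, coeff_C]
    split_ifs
    · simpa using h1
    · simp
  · rw [Ideal.span_singleton_pow, Ideal.mem_span_singleton, coeff_add, coeff_X_pow,
      if_neg hn.ne, coeff_C_zero, zero_add]
    exact h2

lemma irrZ (n : ℕ) (hn : 0 < n) : Irreducible ((X : ℤ[X]) ^ n + C 2214) := by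
  have hmon : ((X : ℤ[X]) ^ n + C 2214).Monic := monic_X_pow_add_C _ hn.ne'
  refine (eis n hn 2 Int.prime_two (by norm_num) (by norm_num)).irreducible ?_ hmon.isPrimitive ?_
  · rw [Ideal.span_singleton_prime (by norm_num)]; exact Int.prime_two
  · rw [natDegree_X_pow_add_C]; exact hn

lemma irrQ (n : ℕ) (hn : 0 < n) :
    Irreducible (((X : ℤ[X]) ^ n + C 2214).map (Int.castRingHom ℚ)) := by
  have hmon : ((X : ℤ[X]) ^ n + C 2214).Monic := monic_X_pow_add_C _ hn.ne'
  exact (Polynomial.IsPrimitive.Int.irreducible_iff_irreducible_map_cast hmon.isPrimitive).mp (irrZ n hn)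

section
variable {K : Type*} [Field K] [NumberField K] (α : K) (n : ℕ) (hn : 0 < n)
  (hα : α ^ n = -2214)
include hn hα

lemma isInt : IsIntegral ℤ α :=
  ⟨X ^ n + C 2214, monic_X_pow_add_C _ hn.ne', by simp [hα]⟩

lemma minQ : minpoly ℚ α = X ^ n + C 2214 := by
  have h := irrQ n hn
  have h2 : ((X : ℤ[X]) ^ n + C 2214).map (Int.castRingHom ℚ) = X ^ n + C 2214 := by
    rw [Polynomial.map_add, Polynomial.map_pow, map_X, Polynomial.map_C]; norm_num
  rw [h2] at h
  refine (minpoly.eq_of_irreducible_of_monic h ?_ (monic_X_pow_add_C _ hn.ne')).symm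
  simp [hα]

lemma minZ : minpoly ℤ α = X ^ n + C 2214 := by
  have h := minpoly.isIntegrallyClosed_eq_field_fractions ℚ K (isInt α n hn hα)
  rw [Algebra.algebraMap_self, RingHom.id_apply, minQ α n hn hα] at h
  apply map_injective (algebraMap ℤ ℚ) (RingHom.injective_int _)
  rw [← h, Polynomial.map_add, Polynomial.map_pow, map_X, Polynomial.map_C]; norm_num

variable (hgen : Algebra.adjoin ℚ {α} = ⊤)
include hgen

lemma exists_pb : ∃ pb : PowerBasis ℚ K, pb.gen = α ∧ pb.dim = n := by
  have hi : IsIntegral ℚ α := Algebra.IsIntegral.isIntegral α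
  refine ⟨PowerBasis.ofAdjoinEqTop hi hgen, by simp, ?_⟩
  rw [← PowerBasis.natDegree_minpoly]
  simp [minQ α n hn hα]

lemma finrank_eq : Module.finrank ℚ K = n := by
  obtain ⟨pb, h1, h2⟩ := exists_pb α n hn hα hgen
  rw [pb.finrank, h2]

lemma norm_eq : (Algebra.norm ℚ α) = (-1) ^ n * 2214 := by
  obtain ⟨pb, h1, h2⟩ := exists_pb α n hn hα hgen
  rw [← h1, Algebra.PowerBasis.norm_gen_eq_coeff_zero_minpoly, h1, h2, minQ α n hn hα]
  simp [hn.ne]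

lemma discr_abs (pb : PowerBasis ℚ K) (h1 : pb.gen = α) :
    |Algebra.discr ℚ pb.basis| = (n : ℚ) ^ n * 2214 ^ (n - 1) := by
  rw [Algebra.discr_powerBasis_eq_norm, h1, minQ α n hn hα]
  simp only [derivative_add, derivative_X_pow, derivative_C, add_zero, map_mul, map_pow, aeval_X,
    aeval_C, norm_eq α n hn hα hgen, abs_mul, abs_pow]
  simp [abs_mul]
  rw [← map_natCast (algebraMap ℚ K), Algebra.norm_algebraMap, finrank_eq α n hn hα hgen]
  simp

lemma trace_pow (j : ℕ) (hj : 0 < j) (hjn : j < n) : Algebra.trace ℚ K (α ^ j) = 0 := by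
  obtain ⟨pb, h1, h2⟩ := exists_pb α n hn hα hgen
  rw [Algebra.trace_eq_matrix_trace pb.basis, Matrix.trace]
  apply Finset.sum_eq_zero
  intro i _
  rw [Matrix.diag_apply, Algebra.leftMulMatrix_eq_repr_mul, pb.basis_eq_pow, h1, ← pow_add]
  have hi := i.2
  by_cases h : j + (i : ℕ) < n
  · have : α ^ (j + (i : ℕ)) = pb.basis ⟨j + i, by omega⟩ := by rw [pb.basis_eq_pow, h1]
    rw [this, Module.Basis.repr_self, Finsupp.single_apply, if_neg]
    intro h3
    have := congrArg Fin.val h3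
    simp at this; omega
  · have : α ^ (j + (i : ℕ)) = (-2214 : ℚ) • pb.basis ⟨j + i - n, by omega⟩ := by
      rw [pb.basis_eq_pow, h1]
      have : j + (i : ℕ) = n + (j + i - n) := by omega
      conv_lhs => rw [this, pow_add, hα]
      simp [Algebra.smul_def]
    rw [this, map_smul, Module.Basis.repr_self, Finsupp.smul_apply, Finsupp.single_apply, if_neg]
    · simp
    intro h3
    have := congrArg Fin.val h3
    simp at this; omega

end

/-- if `A/μ` is reduced then `A` is closed under integral division by `μ`. -/
lemma red_step {K : Type*} [Field K] (A : Subalgebra ℤ K) (μ z : K) (hμ : μ ∈ A)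
    (hμ0 : μ ≠ 0)
    (hred : ∀ y ∈ A, ∀ k : ℕ, (∃ a ∈ A, y ^ k = μ * a) → ∃ a ∈ A, y = μ * a)
    (hz : IsIntegral ℤ z) (h : μ * z ∈ A) : z ∈ A := by
  obtain ⟨P, hP, hPz⟩ := hz
  have key : ∃ a ∈ A, (μ * z) ^ P.natDegree = μ * a := by
    refine ⟨-∑ i ∈ Finset.range P.natDegree,
      (P.coeff i : K) * μ ^ (P.natDegree - 1 - i) * (μ * z) ^ i, ?_, ?_⟩
    · apply neg_mem
      apply sum_mem
      intro i _
      exact mul_mem (mul_mem (intCast_mem A _) (pow_mem hμ _)) (pow_mem h _)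
    · rw [hP.as_sum] at hPz
      simp only [eval₂_add, eval₂_pow, eval₂_X, eval₂_finsetSum, eval₂_mul, eval₂_C] at hPz
      simp only [algebraMap_int_eq, eq_intCast] at hPz
      rw [mul_pow, eq_neg_of_add_eq_zero_left hPz, mul_neg, mul_neg, Finset.mul_sum,
        Finset.mul_sum]
      congr 1
      apply Finset.sum_congr rfl
      intro i hi
      rw [Finset.mem_range] at hi
      have : P.natDegree = 1 + (P.natDegree - 1 - i) + i := by omega
      conv_lhs => rw [this, pow_add, pow_add]
      rw [mul_pow]; ring
  obtain ⟨a, ha, hh⟩ := hred _ h _ key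
  rwa [mul_left_cancel₀ hμ0 hh]

lemma dvd_mod (ℓ : ℕ) [Fact ℓ.Prime] (q : ℕ) (hq : (q : ZMod ℓ) ≠ 0) (hl : ℓ ∣ 2215) (p r s : ℤ[X]) (k : ℕ)
    (h : p ^ k = (X ^ q - 1) * r + (X ^ (5 * q) + C 2214) * s) :
    ((X : (ZMod ℓ)[X]) ^ q - 1) ∣ p.map (Int.castRingHom (ZMod ℓ)) := by
  have hs : (X ^ q - 1 : (ZMod ℓ)[X]).Separable := X_pow_sub_one_separable_iff.mpr hq
  apply hs.squarefree.isRadical k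
  have h' := congrArg (Polynomial.map (Int.castRingHom (ZMod ℓ))) h
  have h4 : (2214 : ZMod ℓ) = -1 := by
    have : ((2215 : ℕ) : ZMod ℓ) = 0 := (ZMod.natCast_eq_zero_iff _ _).mpr hl
    push_cast at this
    linear_combination this
  simp only [Polynomial.map_pow, Polynomial.map_add, Polynomial.map_mul, Polynomial.map_sub,
    map_X, Polynomial.map_one, map_C] at h'
  rw [h', show (Int.castRingHom (ZMod ℓ)) 2214 = -1 by simpa using h4]
  have : (X : (ZMod ℓ)[X]) ^ q - 1 ∣ X ^ (5 * q) + C (-1) := by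
    rw [mul_comm, pow_mul, C_neg, C_1, ← sub_eq_add_neg]
    exact sub_one_dvd_pow_sub_one _ _
  exact dvd_add (dvd_mul_right _ _) (this.mul_right _)

lemma five_red {K : Type*} [Field K] [NumberField K] (α : K) (q : ℕ) (hq : q = 9 ∨ q = 27)
    (hα : α ^ (5 * q) = -2214) (y : K) (hy : y ∈ Algebra.adjoin ℤ {α}) (k : ℕ)
    (h : ∃ a ∈ Algebra.adjoin ℤ {α}, y ^ k = (α ^ q - 1) * a) :
    ∃ a ∈ Algebra.adjoin ℤ {α}, y = (α ^ q - 1) * a := by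
  have hq0 : 0 < q := by rcases hq with rfl | rfl <;> norm_num
  obtain ⟨a, ha, hya⟩ := h
  rw [Algebra.adjoin_singleton_eq_range_aeval] at hy ha
  obtain ⟨p, rfl⟩ := hy
  obtain ⟨r, rfl⟩ := ha
  have hd : (X ^ (5 * q) + C 2214 : ℤ[X]) ∣ p ^ k - (X ^ q - 1) * r := by
    rw [← minZ α (5 * q) (by omega) hα]
    apply minpoly.isIntegrallyClosed_dvd (isInt α (5 * q) (by omega) hα)
    simp only [map_sub, map_pow, map_mul, aeval_X, map_one]
    exact sub_eq_zero.mpr hya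
  obtain ⟨s, hs⟩ := hd
  have hs' : p ^ k = (X ^ q - 1) * r + (X ^ (5 * q) + C 2214) * s := by
    rw [← hs]; ring
  have : Fact (Nat.Prime 5) := ⟨by norm_num⟩
  have : Fact (Nat.Prime 443) := ⟨by norm_num⟩
  have h5 := dvd_mod 5 q (by rw [Ne, ZMod.natCast_eq_zero_iff]; rcases hq with rfl | rfl <;> norm_num) (by norm_num) p r s k hs'
  have h443 := dvd_mod 443 q (by rw [Ne, ZMod.natCast_eq_zero_iff]; rcases hq with rfl | rfl <;> norm_num) (by norm_num) p r s k hs'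
  have hmon : (X ^ q - 1 : ℤ[X]).Monic := monic_X_pow_sub_C 1 hq0.ne'
  have hco (ℓ : ℕ) [Fact ℓ.Prime]
      (h : ((X : (ZMod ℓ)[X]) ^ q - 1) ∣ p.map (Int.castRingHom (ZMod ℓ))) (i : ℕ) :
      (ℓ : ℤ) ∣ (p %ₘ (X ^ q - 1)).coeff i := by
    rw [← ZMod.intCast_zmod_eq_zero_iff_dvd, ← eq_intCast (Int.castRingHom (ZMod ℓ)), ← coeff_map,
      map_modByMonic _ hmon]
    have : (X ^ q - 1 : ℤ[X]).map (Int.castRingHom (ZMod ℓ)) = X ^ q - 1 := by simp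
    rw [this, (modByMonic_eq_zero_iff_dvd (by simpa using monic_X_pow_sub_C (1 : ZMod ℓ) hq0.ne')).mpr h, coeff_zero]
  have hC : C (2215 : ℤ) ∣ p %ₘ (X ^ q - 1) := by
    rw [C_dvd_iff_dvd_coeff]
    intro i
    have e1 := hco 5 h5 i
    have e2 := hco 443 h443 i
    push_cast at e1 e2
    have := IsCoprime.mul_dvd (by norm_num : IsCoprime (5 : ℤ) 443) e1 e2
    simpa using this
  obtain ⟨w, hw⟩ := hC
  have hp := modByMonic_add_div p (X ^ q - 1 : ℤ[X])
  rw [hw] at hp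
  have hA : α ∈ Algebra.adjoin ℤ {α} := Algebra.self_mem_adjoin_singleton ℤ α
  have hmem (u : ℤ[X]) : aeval α u ∈ Algebra.adjoin ℤ {α} := aeval_mem_adjoin_singleton ℤ α
  refine ⟨aeval α (p /ₘ (X ^ q - 1)) +
    (-(1 + α ^ q + (α ^ q) ^ 2 + (α ^ q) ^ 3 + (α ^ q) ^ 4)) * aeval α w, ?_, ?_⟩
  · refine add_mem (hmem _) (mul_mem (neg_mem ?_) (hmem _))
    have := pow_mem hA q
    exact add_mem (add_mem (add_mem (add_mem (one_mem _) this) (pow_mem this _)) (pow_mem this _))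
      (pow_mem this _)
  · show aeval α p = _
    conv_lhs => rw [← hp]
    simp only [map_add, map_mul, map_sub, map_pow, aeval_X, aeval_C, map_one]
    have : (α ^ q) ^ 5 = -2214 := by rw [← pow_mul, mul_comm, hα]
    have h15 : (algebraMap ℤ K) 2215 = 2215 := by simp
    rw [h15]
    linear_combination (aeval α w) * (this)

lemma five_step {K : Type*} [Field K] [NumberField K] (α : K) (q : ℕ) (hq : q = 9 ∨ q = 27)
    (hα : α ^ (5 * q) = -2214) (x : K) (hx : IsIntegral ℤ x)
    (h : (5 : K) * x ∈ Algebra.adjoin ℤ {α}) : x ∈ Algebra.adjoin ℤ {α} := by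
  have hA : α ∈ Algebra.adjoin ℤ {α} := Algebra.self_mem_adjoin_singleton ℤ α
  have h5 : (α ^ q) ^ 5 = -2214 := by rw [← pow_mul, mul_comm, hα]
  have hi := isInt α (5 * q) (by omega) hα
  set μ := α ^ q - 1 with hμ
  have hμA : μ ∈ Algebra.adjoin ℤ {α} := sub_mem (pow_mem hA _) (one_mem _)
  have hμ0 : μ ≠ 0 := by
    intro h0
    have : α ^ q = 1 := by rw [hμ] at h0; linear_combination h0
    rw [this] at h5
    norm_num at h5
  have hμi : IsIntegral ℤ μ := (hi.pow _).sub isIntegral_one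
  have step (z : K) (hz : IsIntegral ℤ z) (h : μ * z ∈ Algebra.adjoin ℤ {α}) :
      z ∈ Algebra.adjoin ℤ {α} :=
    red_step _ μ z hμA hμ0 (fun y hy k hk => five_red α q hq hα y hy k hk) hz h
  have e : μ * (μ * (μ * (μ * (μ * x)))) = -(443 + μ + 2 * μ ^ 2 + 2 * μ ^ 3 + μ ^ 4) * (5 * x) := by
    have : α ^ q = μ + 1 := by rw [hμ]; ring
    rw [this] at h5
    linear_combination x * h5
  have nat (c : ℕ) : (c : K) ∈ Algebra.adjoin ℤ {α} := natCast_mem _ _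
  have e2 : μ * (μ * (μ * (μ * (μ * x)))) ∈ Algebra.adjoin ℤ {α} := by
    rw [e]
    refine mul_mem (neg_mem ?_) h
    exact add_mem (add_mem (add_mem (add_mem (by exact_mod_cast nat 443) hμA)
      (mul_mem (by exact_mod_cast nat 2) (pow_mem hμA _)))
      (mul_mem (by exact_mod_cast nat 2) (pow_mem hμA _))) (pow_mem hμA _)
  exact step _ hx <| step _ (hμi.mul hx) <| step _ (hμi.mul <| hμi.mul hx) <|
    step _ (hμi.mul <| hμi.mul <| hμi.mul hx) <| step _ (hμi.mul <| hμi.mul <| hμi.mul <| hμi.mul hx) e2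

lemma three_pow {K : Type*} [Field K] [NumberField K] (α : K) (q : ℕ) (hq : q = 9 ∨ q = 27)
    (hα : α ^ (5 * q) = -2214) (hgen : Algebra.adjoin ℚ {α} = ⊤) (x : K) (hx : IsIntegral ℤ x) :
    ∃ k : ℕ, (3 : K) ^ k * x ∈ Algebra.adjoin ℤ {α} := by
  have hq0 : 0 < q := by rcases hq with rfl | rfl <;> norm_num
  have hn : 0 < 5 * q := by omega
  have hi := isInt α (5 * q) hn hα
  obtain ⟨pb, h1, h2⟩ := exists_pb α (5 * q) hn hα hgen
  have hd := Algebra.discr_mul_isIntegral_mem_adjoin (K := ℚ) (R := ℤ) (B := pb) (by rw [h1]; exact hi) hx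
  have habs := discr_abs α (5 * q) hn hα hgen pb h1
  rw [h1] at hd
  have hN : (((5 * q : ℕ) : K) ^ (5 * q) * 2214 ^ (5 * q - 1)) * x ∈ Algebra.adjoin ℤ {α} := by
    rw [Algebra.smul_def] at hd
    rcases abs_choice (Algebra.discr ℚ pb.basis) with h | h
    · rw [h] at habs
      rw [habs] at hd
      simpa using hd
    · rw [h] at habs
      have : Algebra.discr ℚ pb.basis = -(((5 * q : ℕ) : ℚ) ^ (5 * q) * 2214 ^ (5 * q - 1)) := by
        rw [← habs]; ring
      rw [this] at hd
      have := neg_mem hd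
      simpa using this
  have hE (p : ℤ) (hp : Prime p) (h1' : p ∣ 2214) (h2' : ¬ p ^ 2 ∣ 2214) (k : ℕ) (z : K)
      (hz : IsIntegral ℤ z) (h : (p : K) ^ k * z ∈ Algebra.adjoin ℤ {α}) :
      z ∈ Algebra.adjoin ℤ {α} := by
    have := mem_adjoin_of_smul_prime_pow_smul_of_minpoly_isEisensteinAt (K := ℚ) (R := ℤ) (B := pb) hp (n := k)
      (by rw [h1]; exact hi) hz (by rw [h1, Algebra.smul_def]; simpa using h)
      (by rw [h1, minZ α (5 * q) hn hα]; exact eis _ hn p hp h1' h2')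
    rwa [h1] at this
  have h5 (k : ℕ) : ∀ (z : K) (hz : IsIntegral ℤ z) (h : (5 : K) ^ k * z ∈ Algebra.adjoin ℤ {α}),
      z ∈ Algebra.adjoin ℤ {α} := by
    induction k with
    | zero => intro z _ h; simpa using h
    | succ k ih =>
      intro z hz h
      refine five_step α q hq hα z hz (ih _ ((show IsIntegral ℤ (5 : K) by exact_mod_cast isIntegral_natCast (R := ℤ) (B := K) 5).mul hz) ?_)
      rw [← mul_assoc, ← pow_succ]; exact h
  have i2 (p k : ℕ) : IsIntegral ℤ ((p : K) ^ k) := IsIntegral.pow (isIntegral_natCast p) k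
  obtain ⟨a, b, c, d, hf⟩ : ∃ a b c d : ℕ, ((5 * q : ℕ) : K) ^ (5 * q) * 2214 ^ (5 * q - 1) =
      2 ^ a * (41 ^ b * (5 ^ c * 3 ^ d)) := by
    have : (2214 : K) = 2 * 41 * 3 ^ 3 := by norm_num
    rw [this]
    have fac (A N M : ℕ) : ((5 : K) * 3 ^ A) ^ N * (2 * 41 * 3 ^ 3) ^ M =
        2 ^ M * (41 ^ M * (5 ^ N * 3 ^ (A * N + 3 * M))) := by
      simp only [mul_pow, pow_add, pow_mul]; ring
    rcases hq with rfl | rfl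
    · refine ⟨_, _, _, _, Eq.trans ?_ (fac 2 (5 * 9) (5 * 9 - 1))⟩
      have : ((5 * 9 : ℕ) : K) = 5 * 3 ^ 2 := by norm_num
      rw [this]
    · refine ⟨_, _, _, _, Eq.trans ?_ (fac 3 (5 * 27) (5 * 27 - 1))⟩
      have : ((5 * 27 : ℕ) : K) = 5 * 3 ^ 3 := by norm_num
      rw [this]
  rw [hf, mul_assoc, mul_assoc, mul_assoc] at hN
  refine ⟨d, ?_⟩
  have j3 := (i2 3 d).mul hx
  have j5 := (i2 5 c).mul j3
  have j41 := (i2 41 b).mul j5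
  push_cast at j3 j5 j41
  have k41 := hE 2 Int.prime_two (by norm_num) (by norm_num) a _ j41 (by simpa using hN)
  have k5 := hE 41 (Int.prime_iff_natAbs_prime.mpr (by norm_num)) (by norm_num) (by norm_num)
    b _ j5 (by simpa using k41)
  exact h5 c _ j3 k5

end Ex16

namespace Ex16

section
variable {K Γ : Type*} [Field K] [LinearOrderedCommGroupWithZero Γ]

lemma val_int_le (v : Valuation K Γ) (hv : ∀ x : K, IsIntegral ℤ x → v x ≤ 1) (c : ℤ) :
    v (c : K) ≤ 1 := hv _ (isIntegral_algebraMap (R := ℤ) (x := c))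

lemma val_int (v : Valuation K Γ) (hv : ∀ x : K, IsIntegral ℤ x → v x ≤ 1) (h3 : v 3 < 1)
    (c : ℤ) (hc : ¬ (3 : ℤ) ∣ c) : v (c : K) = 1 := by
  refine le_antisymm (val_int_le v hv c) (not_lt.mp fun h => ?_)
  have hcop : IsCoprime (3 : ℤ) c :=
    (Prime.coprime_iff_not_dvd Int.prime_three).mpr hc
  obtain ⟨a, b, hab⟩ := hcop
  have h1 : (a : K) * 3 + b * c = 1 := by exact_mod_cast congrArg (Int.cast (R := K)) hab
  have : v ((a : K) * 3 + b * c) < 1 := by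
    refine Valuation.map_add_lt v ?_ ?_
    · rw [map_mul]
      exact mul_lt_one_of_nonneg_of_lt_one_right (val_int_le v hv a) zero_le h3
    · rw [map_mul]
      exact mul_lt_one_of_nonneg_of_lt_one_right (val_int_le v hv b) zero_le h
  rw [h1, map_one] at this
  exact lt_irrefl _ this

lemma val_dvd (v : Valuation K Γ) (hv : ∀ x : K, IsIntegral ℤ x → v x ≤ 1) 
    (c : ℤ) (hc : (3 : ℤ) ∣ c) : v (c : K) ≤ v 3 := by
  obtain ⟨d, rfl⟩ := hc
  push_cast
  rw [map_mul]
  exact mul_le_of_le_one_right zero_le (val_int_le v hv d)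

lemma ultra (v : Valuation K Γ) (hv : ∀ x : K, IsIntegral ℤ x → v x ≤ 1) (h3 : v 3 < 1)
    {ι : Type*} (s : Finset ι) (w : ι → K) (c : ι → ℤ)
    (hw : ∀ i ∈ s, v 3 < v (w i)) (hw1 : ∀ i ∈ s, v (w i) ≤ 1)
    (hinj : ∀ i ∈ s, ∀ j ∈ s, i ≠ j → v (w i) ≠ v (w j))
    (hs : v (∑ i ∈ s, (c i : K) * w i) ≤ v 3) : ∀ i ∈ s, (3 : ℤ) ∣ c i := by
  classical
  by_contra hcon
  push Not at hcon
  have hne : (s.filter fun i => ¬ (3 : ℤ) ∣ c i).Nonempty := by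
    obtain ⟨i, hi, h⟩ := hcon
    exact ⟨i, by simp [hi, h]⟩
  obtain ⟨i, hi, hmax⟩ := Finset.exists_max_image _ (fun i => v (w i)) hne
  rw [Finset.mem_filter] at hi
  have hvi : v ((c i : K) * w i) = v (w i) := by
    rw [map_mul, val_int v hv h3 _ hi.2, one_mul]
  have := Valuation.map_sum_eq_of_lt v (f := fun i => (c i : K) * w i) hi.1 (by
    intro j hj
    rw [Finset.mem_sdiff, Finset.mem_singleton] at hj
    rw [hvi, map_mul]
    by_cases hd : (3 : ℤ) ∣ c j
    · calc v (c j) * v (w j) ≤ v 3 * 1 :=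
            mul_le_mul' (val_dvd v hv _ hd) (hw1 j hj.1)
        _ < v (w i) := by rw [mul_one]; exact hw i hi.1
    · rw [val_int v hv h3 _ hd, one_mul]
      exact lt_of_le_of_ne (hmax j (by simp [hj.1, hd])) (hinj j hj.1 i hi.1 hj.2))
  rw [this, hvi] at hs
  exact absurd hs (not_le.mpr (hw i hi.1))

/-- the two types of valuations above `3`. -/
lemma types (v : Valuation K Γ) (l τ : K) (hv : ∀ x : K, IsIntegral ℤ x → v x ≤ 1) (h3 : v 3 < 1)
    (h30 : v 3 ≠ 0)
    (hl : v l ≤ 1) (hτ : v τ ≤ 1) (h1 : l * τ = -27) (h2 : 3 * τ = l ^ 2 - 3 * l + 3) :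
    v l = v 3 ^ 3 ∨ v l ^ 2 = v 3 := by
  have e1 : v l * v τ = v 3 ^ 3 := by
    rw [← map_mul, h1, Valuation.map_neg, ← map_pow]; norm_num
  have hl0 : v l ≠ 0 := by
    intro h; rw [h, zero_mul] at e1; exact pow_ne_zero 3 h30 e1.symm
  have h3p : 0 < v 3 := zero_lt_iff.mpr h30
  rcases lt_trichotomy (v l ^ 2) (v 3) with h | h | h
  · left
    have hl1 : v l < 1 := by
      by_contra hc
      have : v l = 1 := le_antisymm hl (not_lt.mp hc)
      rw [this, one_pow] at h
      exact absurd h (not_lt.mpr h3.le)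
    have : v (3 * τ) = v 3 := by
      rw [h2]
      apply Valuation.map_add_eq_of_lt_right
      refine Valuation.map_sub_lt v (by rwa [map_pow]) ?_
      rw [map_mul]
      exact mul_lt_of_lt_one_right h3p hl1
    rw [map_mul] at this
    have hτ1 : v τ = 1 := by
      exact mul_left_cancel₀ h30 (this.trans (mul_one _).symm)
    rw [hτ1, mul_one] at e1
    exact e1
  · exact Or.inr h
  · exfalso
    have : v (3 * τ) = v l ^ 2 := by
      rw [h2, sub_add, ← map_pow]
      apply Valuation.map_sub_eq_of_lt_left
      rw [map_pow]
      refine lt_of_le_of_lt (Valuation.map_sub v _ _) (max_lt ?_ h)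
      refine lt_of_le_of_lt ?_ h
      rw [map_mul]
      exact mul_le_of_le_one_right zero_le hl
    rw [map_mul] at this
    have e3 : v l ^ 3 = v 3 ^ 4 := by
      calc v l ^ 3 = v l * v l ^ 2 := by rw [pow_succ']
        _ = v 3 * (v l * v τ) := by rw [← this, mul_left_comm]
        _ = v 3 ^ 4 := by rw [e1, ← pow_succ']
    have e4 : (v 3) ^ 3 < (v 3) ^ 8 := by
      calc (v 3) ^ 3 < (v l ^ 2) ^ 3 := pow_lt_pow_left₀ h zero_le (by norm_num)
        _ = (v l ^ 3) ^ 2 := by rw [← pow_mul, ← pow_mul]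
        _ = v 3 ^ 8 := by rw [e3, ← pow_mul]
    have e5 : (v 3) ^ 8 < (v 3) ^ 3 := pow_lt_pow_right_of_lt_one₀ h3p h3 (by norm_num)
    exact lt_asymm e4 e5

end

end Ex16

namespace Ex16

noncomputable section

def dl {K : Type*} [Field K] (α : K) (m : ℕ) : K := α ^ m / 3
def lam {K : Type*} [Field K] (α : K) (m : ℕ) : K := 1 + dl α m
def tau {K : Type*} [Field K] (α : K) (m : ℕ) : K := (dl α m ^ 2 - dl α m + 1) / 3

def bas {K : Type*} [Field K] (α : K) (m : ℕ) (j : Fin 3 × Fin m) : K :=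
  if j.1 = 0 then α ^ (j.2 : ℕ)
  else if j.1 = 1 then
    (if 2 * (j.2 : ℕ) < m then α ^ (j.2 : ℕ) * lam α m else α ^ (j.2 : ℕ) * lam α m / 3)
  else α ^ (j.2 : ℕ) * lam α m ^ 2 / 3

end

section
variable {K : Type*} [Field K] [NumberField K] (α : K) (m : ℕ) (hm : m = 15 ∨ m = 45)
  (hα : α ^ (3 * m) = -2214)
include hα

lemma dl3 : dl α m ^ 3 = -82 := by
  have : (α ^ m) ^ 3 = -2214 := by rw [← pow_mul, mul_comm, hα]
  rw [dl, div_pow, this]; norm_num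

lemma lam_tau : lam α m * tau α m = -27 := by
  have := dl3 α m hα
  rw [lam, tau]
  field_simp
  linear_combination this

omit hα in
lemma three_tau : 3 * tau α m = lam α m ^ 2 - 3 * lam α m + 3 := by
  rw [lam, tau]
  field_simp
  ring

omit hα in
lemma lam_sq : lam α m ^ 2 / 3 = tau α m + lam α m - 1 := by
  have := three_tau α m
  field_simp
  linear_combination -this

lemma int_dl : IsIntegral ℤ (dl α m) := by
  refine ⟨X ^ 3 + C 82, monic_X_pow_add_C _ (by norm_num), ?_⟩
  simp [dl3 α m hα]

lemma int_lam : IsIntegral ℤ (lam α m) := isIntegral_one.add (int_dl α m hα)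

lemma int_tau : IsIntegral ℤ (tau α m) := by
  refine ⟨X ^ 3 - X ^ 2 - 27 * X - 243, by monicity!, ?_⟩
  have := dl3 α m hα
  simp only [eval₂_sub, eval₂_mul, eval₂_pow, eval₂_X, eval₂_ofNat, tau]
  field_simp
  linear_combination (dl α m ^ 3 - 3 * dl α m ^ 2 + 3 * dl α m - 83 - 0) * this

include hm

lemma int_al : IsIntegral ℤ α := isInt α (3 * m) (by omega) hα

lemma int_bas (j : Fin 3 × Fin m) : IsIntegral ℤ (bas α m j) := by
  have ha := int_al α m hm hα
  have hl := int_lam α m hα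
  have hl2 : IsIntegral ℤ (lam α m ^ 2 / 3) := by
    rw [lam_sq]
    exact ((int_tau α m hα).add hl).sub isIntegral_one
  rw [bas]
  split_ifs with h1 h2 h3
  · exact ha.pow _
  · exact (ha.pow _).mul hl
  · refine IsIntegral.of_pow (n := 2) (by norm_num) ?_
    have hsq : (α ^ (j.2 : ℕ) * lam α m / 3) ^ 2 =
        α ^ (2 * (j.2 : ℕ) - m) * dl α m * (lam α m ^ 2 / 3) := by
      have : α ^ (2 * (j.2 : ℕ)) = α ^ (2 * (j.2 : ℕ) - m) * (3 * dl α m) := by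
        rw [dl, mul_div_cancel₀ _ (by norm_num), ← pow_add]; congr 1; omega
      rw [div_pow, mul_pow, ← pow_mul, mul_comm (j.2 : ℕ), this]
      ring
    rw [hsq]
    exact ((ha.pow _).mul (int_dl α m hα)).mul hl2
  · rw [mul_div_assoc]
    exact (ha.pow _).mul hl2

variable (hgen : Algebra.adjoin ℚ {α} = ⊤)
include hgen

lemma tr_dl : Algebra.trace ℚ K (dl α m) = 0 := by
  have : dl α m = (1 / 3 : ℚ) • α ^ m := by rw [dl, Algebra.smul_def]; simp; ring
  rw [this, map_smul, trace_pow α (3 * m) (by omega) hα hgen m (by omega) (by omega), smul_zero]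

lemma tr_dl2 : Algebra.trace ℚ K (dl α m ^ 2) = 0 := by
  have : dl α m ^ 2 = (1 / 9 : ℚ) • α ^ (2 * m) := by
    rw [dl, Algebra.smul_def, div_pow, ← pow_mul, mul_comm m]; simp; ring
  rw [this, map_smul, trace_pow α (3 * m) (by omega) hα hgen (2 * m) (by omega) (by omega),
    smul_zero]

lemma tr_comb (a b c : ℚ) : Algebra.trace ℚ K (a • 1 + b • dl α m + c • dl α m ^ 2) = a * (3 * m) := by
  rw [map_add, map_add, map_smul, map_smul, map_smul, tr_dl α m hm hα hgen, tr_dl2 α m hm hα hgen]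
  have := Algebra.trace_algebraMap (R := ℚ) (S := K) (1 : ℚ)
  rw [map_one, finrank_eq α (3 * m) (by omega) hα hgen] at this
  rw [this]; simp

lemma tr_contra (a b c : ℚ) (x : K) (hx : IsIntegral ℤ x) (h : x = a • 1 + b • dl α m + c • dl α m ^ 2) :
    ∃ z : ℤ, (z : ℚ) = a * (3 * m) := by
  have h1 := Algebra.isIntegral_trace (L := ℚ) hx
  rw [h, tr_comb α m hm hα hgen] at h1
  obtain ⟨z, hz⟩ := IsIntegrallyClosed.isIntegral_iff.mp h1
  exact ⟨z, by simpa using hz⟩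

omit hm hα hgen in
lemma hv_int (v : IsDedekindDomain.HeightOneSpectrum (NumberField.RingOfIntegers K)) (x : K)
    (hx : IsIntegral ℤ x) : v.valuation K x ≤ 1 :=
  v.valuation_le_one (K := K) (⟨x, hx⟩ : NumberField.RingOfIntegers K)

omit hm hα hgen in
lemma int_of_val (x : K) (h : ∀ v : IsDedekindDomain.HeightOneSpectrum (NumberField.RingOfIntegers K),
    v.valuation K x ≤ 1) : IsIntegral ℤ x := by
  obtain ⟨y, hy⟩ := IsDedekindDomain.HeightOneSpectrum.mem_integers_of_valuation_le_one K x h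
  rw [← hy]
  exact NumberField.RingOfIntegers.isIntegral_coe y

omit hm hα hgen in
lemma int_three : IsIntegral ℤ (3 : K) := by exact_mod_cast isIntegral_natCast (R := ℤ) (B := K) 3

omit hm hgen in
lemma val_one (v : IsDedekindDomain.HeightOneSpectrum (NumberField.RingOfIntegers K))
    (h : v.valuation K 3 = 1) : v.valuation K (lam α m) = 1 := by
  have h1 := hv_int v _ (int_lam α m hα)
  have h2 := hv_int v _ (int_tau α m hα)
  have e : v.valuation K (lam α m) * v.valuation K (tau α m) = 1 := by
    rw [← map_mul, lam_tau α m hα, Valuation.map_neg, show (27 : K) = 3 ^ 3 by norm_num, map_pow, h,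
      one_pow]
  refine le_antisymm h1 ?_
  rw [← e]
  exact mul_le_of_le_one_right zero_le h2

omit hm hgen in
lemma lam_types (v : IsDedekindDomain.HeightOneSpectrum (NumberField.RingOfIntegers K))
    (h : v.valuation K 3 < 1) : v.valuation K (lam α m) = v.valuation K 3 ^ 3 ∨
      v.valuation K (lam α m) ^ 2 = v.valuation K 3 :=
  types _ _ _ (hv_int v) h (by rw [Valuation.ne_zero_iff]; norm_num)
    (hv_int v _ (int_lam α m hα)) (hv_int v _ (int_tau α m hα)) (lam_tau α m hα) (three_tau α m)

lemma ex_type1 : ∃ v : IsDedekindDomain.HeightOneSpectrum (NumberField.RingOfIntegers K),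
    v.valuation K 3 < 1 ∧ v.valuation K (lam α m) = v.valuation K 3 ^ 3 := by
  by_contra hcon
  push Not at hcon
  have hl0 : lam α m ≠ 0 := by
    intro h
    have := lam_tau α m hα
    rw [h] at this; norm_num at this
  have hintg : IsIntegral ℤ (3 / lam α m ^ 2) := by
    apply int_of_val
    intro v
    rw [map_div₀, map_pow]
    rcases (hv_int v _ int_three).lt_or_eq with h | h
    · rw [((lam_types α m hα v h).resolve_left (hcon v h))]
      exact div_self_le_one _
    · rw [h, val_one α m hα v h]; simp
  obtain ⟨z, hz⟩ := tr_contra α m hm hα hgen (165 / 2187) (-84 / 2187) (3 / 2187) _ hintg (by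
    have h1 := dl3 α m hα
    have h2 := lam_tau α m hα
    have : 3 / lam α m ^ 2 = tau α m ^ 2 / 243 := by
      field_simp
      linear_combination (- lam α m * tau α m + 27) * h2
    rw [this, tau, Algebra.smul_def, Algebra.smul_def, Algebra.smul_def]
    simp only [eq_ratCast]
    push_cast
    field_simp
    linear_combination 2187 * (dl α m - 2) * h1)
  rcases hm with rfl | rfl
  · have : (z : ℚ) * 2187 = 165 * 45 := by rw [hz]; norm_num
    have : z * 2187 = 165 * 45 := by exact_mod_cast this
    omega
  · have : (z : ℚ) * 2187 = 165 * 135 := by rw [hz]; norm_num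
    have : z * 2187 = 165 * 135 := by exact_mod_cast this
    omega

lemma ex_type2 : ∃ v : IsDedekindDomain.HeightOneSpectrum (NumberField.RingOfIntegers K),
    v.valuation K 3 < 1 ∧ v.valuation K (lam α m) ^ 2 = v.valuation K 3 := by
  by_contra hcon
  push Not at hcon
  have hintg : IsIntegral ℤ (lam α m / 27) := by
    apply int_of_val
    intro v
    rw [map_div₀, show (27 : K) = 3 ^ 3 by norm_num, map_pow]
    rcases (hv_int v _ int_three).lt_or_eq with h | h
    · rw [((lam_types α m hα v h).resolve_right (hcon v h))]
      exact div_self_le_one _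
    · rw [h, val_one α m hα v h]; simp
  obtain ⟨z, hz⟩ := tr_contra α m hm hα hgen (1 / 729) (2 / 729) (1 / 729) _ (hintg.pow 2) (by
    rw [lam, Algebra.smul_def, Algebra.smul_def, Algebra.smul_def]
    simp only [eq_ratCast]
    push_cast
    field_simp
    ring)
  rcases hm with rfl | rfl
  · have : (z : ℚ) * 729 = 45 := by rw [hz]; norm_num
    have : z * 729 = 45 := by exact_mod_cast this
    omega
  · have : (z : ℚ) * 729 = 135 := by rw [hz]; norm_num
    have : z * 729 = 135 := by exact_mod_cast this
    omega

end

end Ex16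

namespace Ex16

section
variable {K : Type*} [Field K] [NumberField K] (α : K) (m : ℕ) (hm : m = 15 ∨ m = 45)
  (hα : α ^ (3 * m) = -2214)
include hm hα

lemma val_al (v : IsDedekindDomain.HeightOneSpectrum (NumberField.RingOfIntegers K))
    (h : v.valuation K 3 < 1) : v.valuation K α ^ m = v.valuation K 3 := by
  have h82 : v.valuation K ((82 : ℤ) : K) = 1 := val_int _ (hv_int v) h 82 (by norm_num)
  have : (v.valuation K α ^ m) ^ 3 = v.valuation K 3 ^ 3 := by
    rw [← pow_mul, mul_comm, ← map_pow, hα, Valuation.map_neg,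
      show (2214 : K) = 3 ^ 3 * ((82 : ℤ) : K) by norm_num, map_mul, h82, mul_one, map_pow]
  exact (pow_left_inj₀ zero_le zero_le (by norm_num)).mp this

lemma step (hgen : Algebra.adjoin ℚ {α} = ⊤) (x : K) (hx : IsIntegral ℤ x)
    (h : 3 * x ∈ Submodule.span ℤ (Set.range (bas α m))) :
    x ∈ Submodule.span ℤ (Set.range (bas α m)) := by
  rw [Submodule.mem_span_range_iff_exists_fun] at h ⊢
  obtain ⟨c, hc⟩ := h
  have hsum : ∑ i, (c (0, i) : K) * α ^ (i : ℕ) +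
      ∑ j ∈ Finset.univ.filter (fun j : Fin 3 × Fin m => j.1 ≠ 0), (c j : K) * bas α m j = 3 * x := by
    rw [← hc, ← Finset.sum_filter_add_sum_filter_not Finset.univ (fun j : Fin 3 × Fin m => j.1 = 0)]
    congr 1
    · rw [← Finset.univ_product_univ]
      symm
      refine Finset.sum_nbij' (fun j => j.2) (fun i => ((0 : Fin 3), i)) ?_ ?_ ?_ ?_ ?_
      · simp
      · simp
      · rintro ⟨a, b⟩ hab
        simp at hab
        simp [hab]
      · simp
      · rintro ⟨a, b⟩ hab
        simp at hab
        simp [hab, bas]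
    · apply Finset.sum_congr rfl
      intro j _
      simp
  have hm0 : 0 < m := by omega
  -- type 1
  have key0 : ∀ i : Fin m, (3 : ℤ) ∣ c (0, i) := by
    obtain ⟨v, h3, hl⟩ := ex_type1 α m hm hα hgen
    have hρ := val_al α m hm hα v h3
    have h30 : v.valuation K 3 ≠ 0 := by rw [Valuation.ne_zero_iff]; norm_num
    set t := v.valuation K 3 with ht
    set ρ := v.valuation K α with hρd
    have htp : 0 < t := zero_lt_iff.mpr h30
    have hρ0 : 0 < ρ := by
      refine zero_lt_iff.mpr fun h0 => ?_
      rw [h0, zero_pow hm0.ne'] at hρ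
      exact h30 hρ.symm
    have hρ1 : ρ < 1 := by
      by_contra hcon
      have := one_le_pow₀ (not_lt.mp hcon) (n := m)
      rw [hρ] at this
      exact absurd h3 (not_lt.mpr this)
    have := ultra (v.valuation K) (hv_int v) h3 Finset.univ (fun i : Fin m => α ^ (i : ℕ))
      (fun i => c (0, i)) ?_ ?_ ?_ ?_
    · intro i; exact this i (Finset.mem_univ i)
    · intro i _
      rw [map_pow, ← ht, ← hρ]
      exact pow_lt_pow_right_of_lt_one₀ hρ0 hρ1 i.2
    · intro i _
      rw [map_pow]
      exact pow_le_one₀ zero_le hρ1.le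
    · intro i _ j _ hij
      rw [map_pow, map_pow]
      intro he
      exact hij (Fin.ext (pow_right_injective₀ hρ0 hρ1.ne he))
    · rw [eq_sub_of_add_eq hsum]
      refine (Valuation.map_sub _ _ _).trans (max_le ?_ ?_)
      · rw [map_mul]
        exact mul_le_of_le_one_right zero_le (hv_int v _ hx)
      · apply Valuation.map_sum_le
        intro j hj
        rw [Finset.mem_filter] at hj
        rw [map_mul]
        refine (mul_le_of_le_one_left zero_le (val_int_le _ (hv_int v) _)).trans ?_
        have hp : v.valuation K (α ^ (j.2 : ℕ)) ≤ 1 := by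
          rw [map_pow]; exact pow_le_one₀ zero_le hρ1.le
        rw [bas, if_neg hj.2]
        split_ifs with h1 h2
        · rw [map_mul, hl]
          refine (mul_le_of_le_one_left zero_le hp).trans ?_
          exact pow_le_of_le_one zero_le h3.le (by norm_num)
        · rw [mul_div_assoc, map_mul, map_div₀, hl]
          refine (mul_le_of_le_one_left zero_le hp).trans ?_
          rw [← ht, pow_succ, mul_div_cancel_right₀ _ h30]
          exact pow_le_of_le_one zero_le h3.le (by norm_num)
        · rw [mul_div_assoc, map_mul, map_div₀, map_pow _ (lam α m), hl]
          refine (mul_le_of_le_one_left zero_le hp).trans ?_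
          rw [← ht, ← pow_mul, pow_succ, mul_div_cancel_right₀ _ h30]
          exact pow_le_of_le_one zero_le h3.le (by norm_num)
  have key1 : ∀ j ∈ Finset.univ.filter (fun j : Fin 3 × Fin m => j.1 ≠ 0), (3 : ℤ) ∣ c j := by
    obtain ⟨v, h3, hl⟩ := ex_type2 α m hm hα hgen
    have hρ := val_al α m hm hα v h3
    have h30 : v.valuation K 3 ≠ 0 := by rw [Valuation.ne_zero_iff]; norm_num
    set t := v.valuation K 3 with ht
    set ρ := v.valuation K α with hρd
    have htp : 0 < t := zero_lt_iff.mpr h30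
    have hρ0 : 0 < ρ := by
      refine zero_lt_iff.mpr fun h0 => ?_
      rw [h0, zero_pow hm0.ne'] at hρ
      exact h30 hρ.symm
    have hρ1 : ρ < 1 := by
      by_contra hcon
      have := one_le_pow₀ (not_lt.mp hcon) (n := m)
      rw [hρ] at this
      exact absurd h3 (not_lt.mpr this)
    have hsq (j : Fin 3 × Fin m) (hj : j.1 ≠ 0) : ∃ e : ℕ, v.valuation K (bas α m j) ^ 2 = ρ ^ e ∧
        ((j.1 = 1 ∧ 2 * (j.2 : ℕ) < m ∧ e = 2 * j.2 + m) ∨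
         (j.1 = 1 ∧ m ≤ 2 * (j.2 : ℕ) ∧ e + m = 2 * j.2) ∨ (j.1 = 2 ∧ e = 2 * j.2)) := by
      rw [bas, if_neg hj]
      split_ifs with h1 h2
      · refine ⟨_, ?_, Or.inl ⟨h1, h2, rfl⟩⟩
        rw [map_mul, mul_pow, hl, map_pow, ← pow_mul, ← hρ, pow_add, mul_comm 2]
      · refine ⟨2 * j.2 - m, ?_, Or.inr (Or.inl ⟨h1, by omega, by omega⟩)⟩
        rw [map_div₀, map_mul, div_pow, mul_pow, hl, map_pow, ← pow_mul, ← ht, sq t,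
          mul_div_mul_right _ _ h30, div_eq_iff h30, ← hρ, ← pow_add]
        congr 1; omega
      · refine ⟨_, ?_, Or.inr (Or.inr ⟨by omega, rfl⟩)⟩
        rw [map_div₀, map_mul, div_pow, mul_pow, map_pow, map_pow, hl, ← ht,
          mul_div_cancel_right₀ _ (pow_ne_zero 2 h30), ← pow_mul, mul_comm 2]
    refine ultra (v.valuation K) (hv_int v) h3 _ (bas α m) c ?_ ?_ ?_ ?_
    · intro j hj
      rw [Finset.mem_filter] at hj
      obtain ⟨e, he, hh⟩ := hsq j hj.2
      rw [← pow_lt_pow_iff_left₀ zero_le zero_le (two_ne_zero), he, ← ht, ← hρ, ← pow_mul]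
      refine pow_lt_pow_right_of_lt_one₀ hρ0 hρ1 ?_
      have := j.2.2
      omega
    · intro j _
      exact hv_int v _ (int_bas α m hm hα j)
    · intro i hi j hj hij heq
      rw [Finset.mem_filter] at hi hj
      obtain ⟨e, he, hh⟩ := hsq i hi.2
      obtain ⟨f, hf, hh'⟩ := hsq j hj.2
      rw [heq, hf] at he
      have hef : f = e := pow_right_injective₀ hρ0 hρ1.ne he
      subst hef
      apply hij
      have hodd : m % 2 = 1 := by omega
      have hi2 := i.2.2
      have hj2 := j.2.2
      refine Prod.ext ?_ (Fin.ext ?_)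
      · omega
      · omega
    · rw [eq_sub_of_add_eq' hsum]
      refine (Valuation.map_sub _ _ _).trans (max_le ?_ ?_)
      · rw [map_mul]
        exact mul_le_of_le_one_right zero_le (hv_int v _ hx)
      · apply Valuation.map_sum_le
        intro i _
        rw [map_mul]
        refine (mul_le_of_le_one_right zero_le ?_).trans (val_dvd _ (hv_int v) _ (key0 i))
        rw [map_pow]; exact pow_le_one₀ zero_le hρ1.le
  have key : ∀ j, (3 : ℤ) ∣ c j := by
    rintro ⟨a, i⟩
    by_cases ha : a = 0
    · rw [ha]; exact key0 i
    · exact key1 _ (by simp [ha])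
  choose d hd using key
  refine ⟨d, ?_⟩
  have h3 : (3 : K) ≠ 0 := by norm_num
  apply mul_left_cancel₀ h3
  rw [← hc, Finset.mul_sum]
  apply Finset.sum_congr rfl
  intro j _
  rw [hd j]
  simp [mul_assoc]

end

end Ex16

namespace Ex16

lemma prod_half (m : ℕ) (hm : m = 15 ∨ m = 45) :
    ∏ i : Fin m, (if 2 * (i : ℕ) < m then (1 : ℚ) else 1 / 3) = (1 / 3) ^ ((m - 1) / 2) := by
  rw [Finset.prod_ite, Finset.prod_const_one, one_mul, Finset.prod_const]
  congr 1
  rcases hm with rfl | rfl <;> decide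

section
variable {K : Type*} [Field K] [NumberField K] (α : K) (m : ℕ) (hm : m = 15 ∨ m = 45)
  (hα : α ^ (3 * m) = -2214)
include hm hα

omit hα in
lemma pow_mem_span (e : ℕ) (he : e < 3 * m) : α ^ e ∈ Submodule.span ℤ (Set.range (bas α m)) := by
  have hm0 : 0 < m := by omega
  have hmem (j : Fin 3 × Fin m) : bas α m j ∈ Submodule.span ℤ (Set.range (bas α m)) :=
    Submodule.subset_span ⟨j, rfl⟩
  set S := Submodule.span ℤ (Set.range (bas α m))
  have g0 (i : ℕ) (hi : i < m) : α ^ i ∈ S := by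
    have := hmem (0, ⟨i, hi⟩); simpa [bas] using this
  have smul3 (c : ℤ) (x : K) (hx : x ∈ S) : (c : K) * x ∈ S := by
    rw [← zsmul_eq_mul]; exact S.smul_mem c hx
  have g1 (i : ℕ) (hi : i < m) : α ^ i * lam α m ∈ S := by
    have := hmem (1, ⟨i, hi⟩)
    simp only [bas] at this
    rw [if_neg (by simp), if_pos trivial] at this
    split_ifs at this
    · exact this
    · have := smul3 3 _ this
      convert! this using 1
      push_cast; field_simp
  have g2 (i : ℕ) (hi : i < m) : α ^ i * lam α m ^ 2 ∈ S := by
    have := hmem (2, ⟨i, hi⟩)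
    simp only [bas] at this
    rw [if_neg (by simp), if_neg (by simp)] at this
    have := smul3 3 _ this
    convert! this using 1
    push_cast; field_simp
  rcases lt_or_ge e m with h | h
  · exact g0 e h
  rcases lt_or_ge e (2 * m) with h' | h'
  · obtain ⟨i, rfl⟩ := Nat.exists_eq_add_of_le h
    have : α ^ (m + i) = ((3 : ℤ) : K) * (α ^ i * lam α m) + ((-3 : ℤ) : K) * α ^ i := by
      rw [lam, dl, pow_add]; push_cast; field_simp; ring
    rw [this]
    exact S.add_mem (smul3 _ _ (g1 i (by omega))) (smul3 _ _ (g0 i (by omega)))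
  · obtain ⟨i, rfl⟩ := Nat.exists_eq_add_of_le h'
    have : α ^ (2 * m + i) = ((9 : ℤ) : K) * (α ^ i * lam α m ^ 2) +
        ((-18 : ℤ) : K) * (α ^ i * lam α m) + ((9 : ℤ) : K) * α ^ i := by
      rw [lam, dl, pow_add, mul_comm 2 m, pow_mul]; push_cast; field_simp; ring
    rw [this]
    exact S.add_mem (S.add_mem (smul3 _ _ (g2 i (by omega))) (smul3 _ _ (g1 i (by omega))))
      (smul3 _ _ (g0 i (by omega)))

lemma adjoin_mem_span (x : K) (hx : x ∈ Algebra.adjoin ℤ {α}) :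
    x ∈ Submodule.span ℤ (Set.range (bas α m)) := by
  rw [Algebra.adjoin_singleton_eq_range_aeval] at hx
  obtain ⟨p, rfl⟩ := hx
  have hmon : (X ^ (3 * m) + C 2214 : ℤ[X]).Monic := monic_X_pow_add_C _ (by omega)
  have hp := modByMonic_add_div p (X ^ (3 * m) + C 2214 : ℤ[X])
  have hz : aeval α (X ^ (3 * m) + C 2214 : ℤ[X]) = 0 := by
    rw [map_add, map_pow, aeval_X, aeval_C, hα]; simp
  have h1 : aeval α p = aeval α (p %ₘ (X ^ (3 * m) + C 2214)) := by
    conv_lhs => rw [← hp]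
    rw [map_add, map_mul, hz, zero_mul, add_zero]
  show aeval α p ∈ _
  have hd : (p %ₘ (X ^ (3 * m) + C 2214 : ℤ[X])).natDegree < 3 * m := by
    have := natDegree_modByMonic_lt p hmon (by
      intro h
      have := congrArg natDegree h
      rw [natDegree_X_pow_add_C, natDegree_one] at this
      omega)
    rwa [natDegree_X_pow_add_C] at this
  rw [h1, aeval_eq_sum_range' hd]
  apply Submodule.sum_mem
  intro i hi
  exact Submodule.smul_mem _ _ (pow_mem_span α m hm i (Finset.mem_range.mp hi))

variable (hgen : Algebra.adjoin ℚ {α} = ⊤)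
include hgen

lemma int_mem_span (x : K) (hx : IsIntegral ℤ x) : x ∈ Submodule.span ℤ (Set.range (bas α m)) := by
  obtain ⟨k, hk⟩ : ∃ k : ℕ, (3 : K) ^ k * x ∈ Algebra.adjoin ℤ {α} := by
    rcases hm with rfl | rfl
    · exact three_pow α 9 (by simp) hα hgen x hx
    · exact three_pow α 27 (by simp) hα hgen x hx
  replace hk := adjoin_mem_span α m hm hα _ hk
  induction k with
  | zero => simpa using hk
  | succ k ih =>
    refine ih ?_
    refine step α m hm hα hgen _ ((int_three.pow k).mul hx) ?_
    rw [← mul_assoc, ← pow_succ']; exact hk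

lemma bas_li : LinearIndependent ℚ (bas α m) := by
  apply linearIndependent_of_top_le_span_of_card_eq_finrank
  · obtain ⟨pb, h1, h2⟩ := exists_pb α (3 * m) (by omega) hα hgen
    rw [← pb.basis.span_eq, Submodule.span_le]
    rintro _ ⟨i, rfl⟩
    rw [pb.basis_eq_pow, h1]
    have := pow_mem_span α m hm (i : ℕ) (by have := i.2; omega)
    exact Submodule.span_le_restrictScalars ℤ ℚ _ this
  · rw [finrank_eq α (3 * m) (by omega) hα hgen]; simp

lemma discr_bas : |Algebra.discr ℚ (bas α m)| * 3 ^ (9 * m - 1) =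
    ((3 * m : ℕ) : ℚ) ^ (3 * m) * 2214 ^ (3 * m - 1) := by
  obtain ⟨pb, h1, h2⟩ := exists_pb α (3 * m) (by omega) hα hgen
  rw [← discr_abs α (3 * m) (by omega) hα hgen pb h1]
  let e : Fin pb.dim ≃ Fin 3 × Fin m := (finCongr h2).trans finProdFinEquiv.symm
  rw [← Algebra.discr_reindex ℚ pb.basis e]
  let T : Matrix (Fin 3) (Fin 3) ℚ := !![1, 1, 1; 0, 1 / 3, 2 / 3; 0, 0, 1 / 9]
  let d : Fin 3 × Fin m → ℚ := fun j =>
    if j.1 = 0 then 1 else if j.1 = 1 then (if 2 * (j.2 : ℕ) < m then 1 else 1 / 3) else 1 / 3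
  let P : Matrix (Fin 3 × Fin m) (Fin 3 × Fin m) ℚ :=
    Matrix.kroneckerMap (fun x y => x * y) T 1 * Matrix.diagonal d
  have hP : bas α m = Matrix.vecMul (pb.basis ∘ e.symm) (P.map (algebraMap ℚ K)) := by
    ext ⟨l, i⟩
    have hb (k : Fin 3) (j : Fin m) : (pb.basis ∘ e.symm) (k, j) = α ^ (m * (k : ℕ)) * α ^ (j : ℕ) := by
      simp [e, h1, ← pow_add, add_comm]
    simp only [Matrix.vecMul, dotProduct, Fintype.sum_prod_type, hb, P, Matrix.map_apply,
      Matrix.mul_diagonal, Matrix.kroneckerMap_apply, Matrix.one_apply]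
    have hs (k : Fin 3) : ∑ x : Fin m, α ^ (m * (k : ℕ)) * α ^ (x : ℕ) *
        (algebraMap ℚ K) (T k l * (if x = i then 1 else 0) * d (l, i)) =
        α ^ (m * (k : ℕ)) * α ^ (i : ℕ) * (algebraMap ℚ K) (T k l * d (l, i)) := by
      rw [Finset.sum_eq_single i]
      · simp
      · intro b _ hb'
        simp [hb']
      · simp
    rw [Fin.sum_univ_three, hs, hs, hs]
    have e2 : α ^ (m * ((2 : Fin 3) : ℕ)) = (α ^ m) ^ 2 := by rw [← pow_mul]; rfl
    have e1 : α ^ (m * ((1 : Fin 3) : ℕ)) = (α ^ m) := by simp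
    have e0 : α ^ (m * ((0 : Fin 3) : ℕ)) = 1 := by simp
    rw [e0, e1, e2]
    fin_cases l
    · simp [bas, T, d]
    · simp only [bas, T, d, lam, dl]
      simp
      split_ifs <;> simp <;> ring
    · simp only [bas, T, d, lam, dl]
      simp
      ring
  have hdet : P.det = (1 / 27) ^ m * ((1 / 3) ^ ((m - 1) / 2) * (1 / 3) ^ m) := by
    simp only [P]
    rw [Matrix.det_mul, Matrix.det_kronecker, Matrix.det_diagonal, Matrix.det_one, one_pow, mul_one,
      Fintype.card_fin]
    congr 1
    · congr 1
      simp [T, Matrix.det_fin_three]; norm_num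
    · rw [Fintype.prod_prod_type, Fin.prod_univ_three]
      simp only [d]
      simp
      simpa using prod_half m hm
  rw [hP, Algebra.discr_of_matrix_vecMul, hdet, abs_mul]
  rw [abs_of_nonneg (sq_nonneg _)]
  have : (((1 / 27 : ℚ)) ^ m * ((1 / 3) ^ ((m - 1) / 2) * (1 / 3) ^ m)) ^ 2 * 3 ^ (9 * m - 1) = 1 := by
    rw [show (1 / 27 : ℚ) = (1 / 3) ^ 3 by norm_num, ← pow_mul, ← pow_add, ← pow_add, ← pow_mul,
      show (3 * m + ((m - 1) / 2 + m)) * 2 = 9 * m - 1 by omega, ← mul_pow]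
    norm_num
  linear_combination |Algebra.discr ℚ (pb.basis ∘ e.symm)| * this

lemma discr_K : |(NumberField.discr K : ℚ)| * 3 ^ (9 * m - 1) =
    ((3 * m : ℕ) : ℚ) ^ (3 * m) * 2214 ^ (3 * m - 1) := by
  rw [← discr_bas α m hm hα hgen]
  let b : Fin 3 × Fin m → NumberField.RingOfIntegers K := fun j => ⟨bas α m j, int_bas α m hm hα j⟩
  have hli : LinearIndependent ℤ b := by
    have h := (bas_li α m hm hα hgen).restrict_scalars' ℤ
    exact LinearIndependent.of_comp (Algebra.linearMap (NumberField.RingOfIntegers K) K |>.restrictScalars ℤ) h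
  have hsp : ⊤ ≤ Submodule.span ℤ (Set.range b) := by
    intro x _
    have := int_mem_span α m hm hα hgen (x : K) x.isIntegral_coe
    rw [Submodule.mem_span_range_iff_exists_fun] at this ⊢
    obtain ⟨c, hc⟩ := this
    refine ⟨c, ?_⟩
    apply NumberField.RingOfIntegers.ext
    rw [← hc]
    refine (map_sum (algebraMap (NumberField.RingOfIntegers K) K) _ _).trans ?_
    apply Finset.sum_congr rfl
    intro j _
    rw [map_zsmul]
    rfl
  let B := Module.Basis.mk hli hsp
  rw [← NumberField.discr_eq_discr K B]
  have := Algebra.discr_localizationLocalization ℤ (nonZeroDivisors ℤ) K (Rₘ := ℚ) B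
  have h2 : ⇑(Module.Basis.localizationLocalization ℚ (nonZeroDivisors ℤ) K B) = bas α m := by
    ext j
    rw [Module.Basis.localizationLocalization_apply]
    simp only [B]
    rw [Module.Basis.mk_apply]
    rfl
  rw [h2] at this
  rw [this]
  simp

end

end Ex16

namespace Ex16

open NumberField

lemma nil41 {K : Type*} [Field K] [NumberField K] (α : 𝓞 K) (hα : α ^ 135 = -2214)
    (h3 : ∀ z : 𝓞 K, ∃ (k : ℕ) (p : ℤ[X]), 3 ^ k * z = aeval α p) (z : 𝓞 K) :
    ∃ (n : ℤ) (w : 𝓞 K), (z - n) ^ 135 = 41 * w := by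
  obtain ⟨k, p, hp⟩ := h3 z
  have h41 : (41 : 𝓞 K) ∣ 42 ^ k - 1 := by
    have := sub_one_dvd_pow_sub_one (42 : 𝓞 K) k
    norm_num at this; exact this
  obtain ⟨s, hs⟩ := h41
  have hX : aeval α p = α * aeval α p.divX + (p.coeff 0 : 𝓞 K) := by
    conv_lhs => rw [← X_mul_divX_add p]
    simp
  have hz : z - ((14 ^ k * p.coeff 0 : ℤ) : 𝓞 K) = α * (14 ^ k * aeval α p.divX) + 41 * (-s * z) := by
    have h42 : (42 : 𝓞 K) ^ k = 14 ^ k * 3 ^ k := by rw [← mul_pow]; norm_num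
    rw [h42] at hs
    push_cast
    linear_combination (14 ^ k) * hp + (14 ^ k) * hX - z * hs
  refine ⟨14 ^ k * p.coeff 0, ?_⟩
  rw [hz]
  set A := 14 ^ k * aeval α p.divX
  set B := -s * z
  obtain ⟨u, hu⟩ := sub_dvd_pow_sub_pow (α * A + 41 * B) (α * A) 135
  refine ⟨B * u - 54 * A ^ 135, ?_⟩
  have : (α * A) ^ 135 = -2214 * A ^ 135 := by rw [mul_pow, hα]
  rw [add_sub_cancel_left] at hu
  rw [eq_add_of_sub_eq hu, this]
  ring

lemma norm_mod {K : Type*} [Field K] [NumberField K] (p : ℕ) [Fact p.Prime] (z w : 𝓞 K) (n : ℤ) (N : ℕ)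
    (h : (z - n) ^ N = p * w) :
    ((Algebra.norm ℤ z : ℤ) : ZMod p) = (n : ZMod p) ^ Module.finrank ℚ K := by
  classical
  let b := RingOfIntegers.basis K
  let M := Algebra.leftMulMatrix b
  let φ := (Int.castRingHom (ZMod p)).mapMatrix (m := Module.Free.ChooseBasisIndex ℤ (𝓞 K))
  have hcard : Fintype.card (Module.Free.ChooseBasisIndex ℤ (𝓞 K)) = Module.finrank ℚ K := by
    rw [← RingOfIntegers.rank K, Module.finrank_eq_card_chooseBasisIndex]
  have hn : IsNilpotent (φ (M (n - z))) := by
    refine ⟨N, ?_⟩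
    rw [← map_pow, ← map_pow, ← neg_sub, neg_pow, h, map_mul, map_mul, map_mul, map_mul]
    have : φ (M (p : 𝓞 K)) = 0 := by
      rw [map_natCast, map_natCast]
      simp [CharP.cast_eq_zero]
    rw [this]; simp
  have hc := Matrix.isNilpotent_charpoly_sub_pow_of_isNilpotent hn
  rw [isNilpotent_iff_eq_zero, sub_eq_zero, hcard] at hc
  have he := congrArg (eval ((n : ℤ) : ZMod p)) hc
  rw [Matrix.eval_charpoly, eval_pow, eval_X] at he
  rw [← he, Algebra.norm_eq_matrix_det b, ← eq_intCast (Int.castRingHom (ZMod p)), RingHom.map_det]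
  congr 1
  show φ (M z) = _
  rw [map_sub, map_sub, map_intCast, map_intCast]
  simp

section
variable {R O F : Type*} [CommRing R] [IsDomain R] [IsIntegrallyClosed R] [CommRing O] [IsDomain O]
  [Algebra R O] [Module.IsTorsionFree R O] [Field F]

lemma hbar (θ : O) (hθ : IsIntegral R θ) (htop : Algebra.adjoin R {θ} = ⊤) (ψ : O →+* F)
    (h41 : ψ 41 = 0) (n : ℤ) (w : O) (N : ℕ) (hN : N ≠ 0) (hw : (θ - n) ^ N = 41 * w) :
    ψ θ = n ∧ (minpoly R θ).map (ψ.comp (algebraMap R O)) =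
      (X - C (n : F)) ^ (minpoly R θ).natDegree := by
  have ht : ψ θ = n := by
    have := congrArg ψ hw
    rw [map_pow, map_mul, h41, zero_mul, map_sub, map_intCast] at this
    exact sub_eq_zero.mp (pow_eq_zero_iff hN |>.mp this)
  refine ⟨ht, ?_⟩
  obtain ⟨W, hW⟩ : ∃ W : R[X], aeval θ W = w := by
    have : w ∈ Algebra.adjoin R {θ} := by rw [htop]; trivial
    rw [Algebra.adjoin_singleton_eq_range_aeval] at this
    exact this
  have hd : minpoly R θ ∣ (X - C (n : R)) ^ N - C 41 * W := by
    apply minpoly.isIntegrallyClosed_dvd hθ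
    have e41 : algebraMap R O 41 = 41 := map_ofNat _ 41
    rw [map_sub, map_pow, map_mul, map_sub, aeval_X, aeval_C, aeval_C, hW, map_intCast, e41]
    exact sub_eq_zero.mpr hw
  have hd2 := Polynomial.map_dvd (ψ.comp (algebraMap R O)) hd
  rw [Polynomial.map_sub, Polynomial.map_mul, map_C, Polynomial.map_pow, Polynomial.map_sub, map_X,
    map_C, RingHom.comp_apply, RingHom.comp_apply, map_ofNat, h41, C_0, zero_mul, sub_zero,
    map_intCast, map_intCast] at hd2
  obtain ⟨i, _, hi⟩ := (dvd_prime_pow (prime_X_sub_C (n : F)) N).mp hd2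
  have hmon := minpoly.monic hθ
  have e := eq_of_monic_of_associated (hmon.map (ψ.comp (algebraMap R O))) ((monic_X_sub_C (n : F)).pow i) hi
  have hdeg := congrArg natDegree e
  rw [hmon.natDegree_map, natDegree_pow, natDegree_X_sub_C, mul_one] at hdeg
  rw [e, hdeg]

lemma local_rel (θ α : O) (hθ : IsIntegral R θ) (htop : Algebra.adjoin R {θ} = ⊤) (ψ : O →+* F)
    (h41 : ψ 41 = 0) (n : ℤ) (w : O) (hw : (θ - n) ^ 135 = 41 * w) (r : ℕ) (hr : 2 ≤ r)
    (hdeg : (minpoly R θ).natDegree = r) (a : R) (ha : algebraMap R O a = α ^ r) (hα : ψ α = 0)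
    (g : R[X]) (hg : aeval θ g = α) :
    ψ (aeval θ (derivative (minpoly R θ))) = 0 ∧
    ∃ S : O, r * α ^ (r - 1) * aeval θ (derivative g) = aeval θ (derivative (minpoly R θ)) * S ∧
      ψ S = ψ (aeval θ (derivative g)) ^ r := by
  obtain ⟨ht, hh⟩ := hbar θ hθ htop ψ h41 n w 135 (by norm_num) hw
  rw [hdeg] at hh
  set φ := ψ.comp (algebraMap R O) with hφ
  have hev (q : R[X]) : ψ (aeval θ q) = (q.map φ).eval (n : F) := by
    rw [eval_map, ← ht, hφ, aeval_def, hom_eval₂]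
  constructor
  · rw [hev, ← derivative_map, hh, derivative_X_sub_C_pow]
    simp
    right
    omega
  have hdvd : minpoly R θ ∣ g ^ r - C a := by
    apply minpoly.isIntegrallyClosed_dvd hθ
    rw [map_sub, map_pow, aeval_C, hg, ha, sub_self]
  obtain ⟨S, hS⟩ := hdvd
  refine ⟨aeval θ S, ?_, ?_⟩
  · have := congrArg (fun q => aeval θ (derivative q)) hS
    simp only [derivative_sub, derivative_C, sub_zero, derivative_pow, derivative_mul, map_add, map_mul,
      minpoly.aeval, zero_mul, add_zero, map_pow, hg, aeval_C, map_natCast] at this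
    exact this
  · have hga : (g.map φ).IsRoot (n : F) := by rw [IsRoot, ← hev, hg, hα]
    obtain ⟨G, hG⟩ := dvd_iff_isRoot.mpr hga
    have h1 : ψ (aeval θ (derivative g)) = G.eval (n : F) := by
      rw [hev, ← derivative_map, hG]; simp
    have h2 := congrArg (Polynomial.map φ) hS
    rw [Polynomial.map_sub, Polynomial.map_pow, Polynomial.map_mul, hh, hG, map_C, mul_pow] at h2
    have h3 : φ a = 0 := by rw [hφ, RingHom.comp_apply, ha, map_pow, hα, zero_pow (by omega)]
    rw [h3, C_0, sub_zero] at h2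
    have h4 := mul_left_cancel₀ (pow_ne_zero r (X_sub_C_ne_zero (n : F))) h2
    rw [h1, hev, ← h4, eval_pow]

end
end Ex16

namespace Ex16

open NumberField

lemma gen_top (A F : Type*) {B L : Type*} [CommRing A] [Field F] [CommRing B] [Field L] [IsDomain A]
    [Algebra A F] [Algebra B L] [Algebra A B] [Algebra F L] [Algebra A L] [IsScalarTower A F L]
    [IsScalarTower A B L] [IsFractionRing A F] [IsIntegralClosure B A L] [Algebra.IsAlgebraic F L]
    (θ : B) (h : Algebra.adjoin A {θ} = ⊤) : Algebra.adjoin F {algebraMap B L θ} = ⊤ := by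
  rw [eq_top_iff]
  intro x _
  have := IsIntegralClosure.isLocalization A F L B
  obtain ⟨b, ⟨s, hs⟩, hx⟩ := IsLocalization.exists_mk'_eq (Algebra.algebraMapSubmonoid B (nonZeroDivisors A)) x
  obtain ⟨a, ha, rfl⟩ := hs
  have ha0 : a ≠ 0 := nonZeroDivisors.ne_zero ha
  rw [IsLocalization.mk'_eq_iff_eq_mul] at hx
  have hb : b ∈ Algebra.adjoin A {θ} := by rw [h]; trivial
  rw [Algebra.adjoin_singleton_eq_range_aeval] at hb
  obtain ⟨p, rfl⟩ := hb
  have e1 : algebraMap B L (aeval θ p) = aeval (algebraMap B L θ) (p.map (algebraMap A F)) := by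
    rw [aeval_map_algebraMap, aeval_algebraMap_apply]
  have haF : algebraMap A F a ≠ 0 := by
    rwa [Ne, IsFractionRing.to_map_eq_zero_iff]
  have e2 : x = (algebraMap A F a)⁻¹ • aeval (algebraMap B L θ) (p.map (algebraMap A F)) := by
    rw [← e1]
    show x = _ • algebraMap B L ((aeval θ).toRingHom p)
    rw [hx, ← IsScalarTower.algebraMap_apply, IsScalarTower.algebraMap_apply A F L, mul_comm,
      ← Algebra.smul_def, smul_smul, inv_mul_cancel₀ haF, one_smul]
  rw [e2]
  exact Subalgebra.smul_mem _ (aeval_mem_adjoin_singleton F _) _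

lemma diff_norm (A F : Type*) {K : Type*} [CommRing A] [Field F] [Field K] [IsDomain A] [NumberField K]
    [Algebra A F] [Algebra A (𝓞 K)] [Algebra F K] [Algebra A K] [IsScalarTower A F K]
    [IsScalarTower A (𝓞 K) K] [IsFractionRing A F] [IsIntegralClosure (𝓞 K) A K]
    [IsIntegrallyClosed A] [Module.IsTorsionFree A (𝓞 K)] [FiniteDimensional F K]
    [Algebra.IsSeparable F K]
    (θ : 𝓞 K) (h : Algebra.adjoin A {θ} = ⊤) :
    Ideal.absNorm (differentIdeal A (𝓞 K)) =
      (Algebra.norm ℤ (aeval θ (derivative (minpoly A θ)))).natAbs := by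
  have h1 := conductor_mul_differentIdeal A F K θ (gen_top A F θ h)
  rw [conductor_eq_top_of_adjoin_eq_top h, Ideal.top_mul] at h1
  rw [h1, Ideal.absNorm_span_singleton]

lemma minpoly_deg (A F : Type*) {K : Type*} [CommRing A] [Field F] [Field K] [IsDomain A] [NumberField K]
    [Algebra A F] [Algebra A (𝓞 K)] [Algebra F K] [Algebra A K] [IsScalarTower A F K]
    [IsScalarTower A (𝓞 K) K] [IsFractionRing A F] [IsIntegralClosure (𝓞 K) A K]
    [IsIntegrallyClosed A] [Module.IsTorsionFree A (𝓞 K)] [FiniteDimensional F K]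
    (θ : 𝓞 K) (h : Algebra.adjoin A {θ} = ⊤) :
    (minpoly A θ).natDegree = Module.finrank F K := by
  have h1 := gen_top A F (L := K) θ h
  have hi : IsIntegral A (algebraMap (𝓞 K) K θ) := IsIntegralClosure.isIntegral_iff.mpr ⟨θ, rfl⟩
  have hiF : IsIntegral F (algebraMap (𝓞 K) K θ) := Algebra.IsIntegral.isIntegral _
  rw [(PowerBasis.ofAdjoinEqTop hiF h1).finrank, ← PowerBasis.natDegree_minpoly,
    PowerBasis.ofAdjoinEqTop_gen]
  rw [minpoly.isIntegrallyClosed_eq_field_fractions' F hi, (minpoly.monic hi).natDegree_map,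
    minpoly.algebraMap_eq (RingOfIntegers.coe_injective (K := K))]

/-- arithmetic contradiction -/
lemma final_F {F : Type*} [Field F] [CharP F 41] (c : F) (hc : c ≠ 0)
    (h1 : 3 ^ 404 * c ^ 135 = (c ^ 135) ^ 135 ∨ 3 ^ 404 * c ^ 135 = -(c ^ 135) ^ 135)
    (h2 : 9 * c ^ 135 = (c ^ 3) ^ 135 ∨ 9 * c ^ 135 = -(c ^ 3) ^ 135) : False := by
  have h41 : (41 : F) = 0 := by exact_mod_cast CharP.cast_eq_zero F 41
  have h8 : (3 : F) ^ 8 = 1 := by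
    have : (3 : F) ^ 8 = 1 + 160 * 41 := by norm_num
    rw [this, h41]; ring
  have h404 : (3 : F) ^ 404 = -1 := by
    have : (3 : F) ^ 404 = (3 ^ 8) ^ 50 * 3 ^ 4 := by rw [← pow_mul, ← pow_add]
    rw [this, h8, one_pow, one_mul]
    have : (3 : F) ^ 4 = -1 + 2 * 41 := by norm_num
    rw [this, h41]; ring
  have h9 : (9 : F) ^ 4 = 1 := by
    rw [← h8]; norm_num
  have hc' : c ^ 135 ≠ 0 := pow_ne_zero _ hc
  have h3 : (c ^ 3) ^ 135 = (c ^ 135) ^ 2 * c ^ 135 := by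
    rw [← pow_succ, ← pow_mul, ← pow_mul]
  rw [h404] at h1
  rw [h3] at h2
  clear h3
  generalize c ^ 135 = d at *
  have e1 : (d ^ 134) ^ 2 = 1 := by
    rcases h1 with h | h
    · have : d ^ 134 = -1 := by
        apply mul_right_cancel₀ hc'
        rw [h, ← pow_succ]
      rw [this]; norm_num
    · have : d ^ 134 = 1 := by
        apply mul_right_cancel₀ hc'
        rw [← pow_succ]
        linear_combination h
      rw [this]; norm_num
  have e2 : (d ^ 2) ^ 2 = 81 := by
    rcases h2 with h | h
    · have : d ^ 2 = 9 := mul_right_cancel₀ hc' h.symm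
      rw [this]; norm_num
    · have : d ^ 2 = -9 := by
        apply mul_right_cancel₀ hc'
        linear_combination h
      rw [this]; norm_num
  have e3 : (d ^ 134) ^ 2 = ((d ^ 2) ^ 2) ^ 67 := by rw [← pow_mul, ← pow_mul, ← pow_mul]
  have h81 : (81 : F) = -1 := by linear_combination 2 * h41
  rw [e1, e2, h81] at e3
  have : (2 : F) = 0 := by
    have h67 : (-1 : F) ^ 67 = -1 := by norm_num
    rw [h67] at e3
    linear_combination e3
  have : (1 : F) = 0 := by linear_combination h41 - 20 * this
  exact one_ne_zero this

end Ex16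

namespace Ex16

open NumberField

lemma norm_psi {K F : Type*} [Field K] [NumberField K] [Field F] [CharP F 41] (ψ : 𝓞 K →+* F)
    (hK : Module.finrank ℚ K = 135) (z w : 𝓞 K) (n : ℤ) (h : (z - n) ^ 135 = 41 * w) :
    ((Algebra.norm ℤ z : ℤ) : F) = ψ z ^ 135 := by
  have : Fact (Nat.Prime 41) := ⟨by norm_num⟩
  have h41 : (41 : F) = 0 := by exact_mod_cast CharP.cast_eq_zero F 41
  have h1 := norm_mod 41 z w n 135 (by exact_mod_cast h)
  rw [hK] at h1
  have h2 : ψ z = (n : F) := by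
    have := congrArg ψ h
    rw [map_pow, map_mul, map_sub, map_intCast, map_ofNat, h41, zero_mul] at this
    exact sub_eq_zero.mp (pow_eq_zero_iff (by norm_num) |>.mp this)
  have h3 := congrArg (ZMod.castHom (dvd_refl 41) F) h1
  rw [map_pow, map_intCast, map_intCast] at h3
  rw [h2, h3]

lemma rel_norm {K : Type*} [Field K] [NumberField K] (A G D S : 𝓞 K) (e : A * G = D * S) (t : ℤ)
    (ht : 0 ≤ t) (hA : |Algebra.norm ℤ A| = |Algebra.norm ℤ D| * t) (hA0 : A ≠ 0) :
    t * Algebra.norm ℤ G = Algebra.norm ℤ S ∨ t * Algebra.norm ℤ G = -Algebra.norm ℤ S := by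
  have hN : Algebra.norm ℤ A ≠ 0 := by
    rw [Ne, Algebra.norm_eq_zero_iff]; exact hA0
  have hD : |Algebra.norm ℤ D| ≠ 0 := by
    intro h; rw [h, zero_mul, abs_eq_zero] at hA; exact hN hA
  have h1 := congrArg (Algebra.norm ℤ) e
  rw [map_mul, map_mul] at h1
  have h2 := congrArg abs h1
  rw [abs_mul, abs_mul, hA, mul_assoc] at h2
  have h3 := mul_left_cancel₀ hD h2
  rw [← abs_eq_abs, abs_mul, abs_of_nonneg ht, h3]

/-- existence of a residue field -/
lemma ex_psi {K : Type*} [Field K] [NumberField K] :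
    ∃ P : Ideal (𝓞 K), P.IsMaximal ∧ (41 : 𝓞 K) ∈ P := by
  have h : Ideal.span {(41 : 𝓞 K)} ≠ ⊤ := by
    intro h
    rw [Ideal.span_singleton_eq_top] at h
    have h2 := h.map (Algebra.norm ℤ)
    rw [show (41 : 𝓞 K) = algebraMap ℤ (𝓞 K) 41 by simp, Algebra.norm_algebraMap] at h2
    rw [isUnit_pow_iff (Module.finrank_pos).ne'] at h2
    rw [Int.isUnit_iff] at h2
    omega
  obtain ⟨P, hP, hle⟩ := Ideal.exists_le_maximal _ h
  exact ⟨P, hP, hle (Ideal.mem_span_singleton_self _)⟩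

lemma c_ne {K F : Type*} [Field K] [NumberField K] [Field F] [CharP F 41] (ψ : 𝓞 K →+* F)
    (θ α : 𝓞 K) (g p : ℤ[X]) (k : ℕ) (hg : aeval θ g = α) (hp : 3 ^ k * θ = aeval α p)
    (hT : ψ (aeval θ (derivative (minpoly ℤ θ))) = 0) : ψ (aeval θ (derivative g)) ≠ 0 := by
  intro hc
  have hθ : IsIntegral ℤ θ := RingOfIntegers.isIntegral θ
  have hd : minpoly ℤ θ ∣ p.comp g - C (3 ^ k) * X := by
    apply minpoly.isIntegrallyClosed_dvd hθ
    have h33 : aeval θ (3 : ℤ[X]) = 3 := map_ofNat _ 3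
    simp [aeval_comp, hg, ← hp, h33]
  obtain ⟨W, hW⟩ := hd
  have h1 := congrArg (fun q => ψ (aeval θ (derivative q))) hW
  simp only [derivative_mul, derivative_sub, derivative_comp, derivative_C, derivative_X, map_sub,
    map_mul, map_add, hc, hT, minpoly.aeval] at h1
  have h33 : aeval θ (3 : ℤ[X]) = 3 := map_ofNat _ 3
  simp [h33] at h1
  have h41 : (41 : F) = 0 := by exact_mod_cast CharP.cast_eq_zero F 41
  have h13 := h1.1
  rw [map_ofNat] at h13
  have : (1 : F) = 0 := by linear_combination 14 * h13 - h41
  exact one_ne_zero this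

lemma discr_ratio (a dk dK : ℚ) (hk : dk * 3 ^ 134 = 45 ^ 45 * 2214 ^ 44)
    (hK : dK * 3 ^ 404 = 135 ^ 135 * 2214 ^ 134) (h : dK = a * dk ^ 3) :
    3 ^ 135 * 2214 ^ 2 = a * 9 := by
  have p1 : (3 : ℚ) ^ 404 = (3 ^ 134) ^ 3 * 9 := by
    rw [← pow_mul, show (9 : ℚ) = 3 ^ 2 by norm_num, ← pow_add]
  have p2 : (135 : ℚ) ^ 135 = 3 ^ 135 * (45 ^ 45) ^ 3 := by
    rw [← pow_mul, ← mul_pow]; norm_num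
  have p3 : (2214 : ℚ) ^ 134 = (2214 ^ 44) ^ 3 * 2214 ^ 2 := by
    rw [← pow_mul, ← pow_add]
  rw [p1, p2, p3, h] at hK
  have h4 : (45 : ℚ) ^ 45 ≠ 0 := by positivity
  have h5 : (2214 : ℚ) ^ 44 ≠ 0 := by positivity
  generalize (3 : ℚ) ^ 134 = x at *
  generalize (45 : ℚ) ^ 45 = y at *
  generalize (2214 : ℚ) ^ 44 = u at *
  generalize (3 : ℚ) ^ 135 = v at *
  generalize (2214 : ℚ) ^ 2 = t at *
  apply mul_right_cancel₀ (pow_ne_zero 3 (mul_ne_zero h4 h5))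
  calc v * t * (y * u) ^ 3 = v * y ^ 3 * (u ^ 3 * t) := by ring
    _ = a * dk ^ 3 * (x ^ 3 * 9) := hK.symm
    _ = a * 9 * (dk * x) ^ 3 := by ring
    _ = _ := by rw [hk]

end Ex16

namespace Ex16

open NumberField

section
universe u
variable {K : Type u} [Field K] [NumberField K] (α : K) (hα : α ^ 135 = -2214)
  (hgen : Algebra.adjoin ℚ {α} = ⊤) (α0 : 𝓞 K) (h0 : algebraMap (𝓞 K) K α0 = α)
include hα hgen h0

lemma norm_al (r : ℕ) (j : ℕ) : |Algebra.norm ℤ ((r : 𝓞 K) * α0 ^ j)| = r ^ 135 * 2214 ^ j := by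
  have hK := finrank_eq α 135 (by norm_num) hα hgen
  have h1 : (Algebra.norm ℤ ((r : 𝓞 K) * α0 ^ j) : ℚ) = r ^ 135 * (-2214) ^ j := by
    rw [Algebra.coe_norm_int]
    change Algebra.norm ℚ (algebraMap (𝓞 K) K ((r : 𝓞 K) * α0 ^ j)) = _
    rw [map_mul (algebraMap (𝓞 K) K), map_pow (algebraMap (𝓞 K) K), h0, map_natCast, map_mul, map_pow, norm_eq α 135 (by norm_num) hα hgen,
      show (r : K) = algebraMap ℚ K r by simp, Algebra.norm_algebraMap, hK]
    norm_num
  have h2 : Algebra.norm ℤ ((r : 𝓞 K) * α0 ^ j) = r ^ 135 * (-2214) ^ j := by exact_mod_cast h1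
  rw [h2, abs_mul, abs_pow, abs_pow]
  simp

variable (θ : 𝓞 K) (h : Algebra.adjoin ℤ {θ} = ⊤)
include h

lemma abs_norm_Z : |Algebra.norm ℤ (aeval θ (derivative (minpoly ℤ θ)))| = |discr K| := by
  have h1 := diff_norm ℤ ℚ θ h
  rw [NumberField.absNorm_differentIdeal K (𝓞 K)] at h1
  rw [Int.abs_eq_natAbs, ← h1, Int.abs_eq_natAbs]

lemma case_Z : |Algebra.norm ℤ (((135 : ℕ) : 𝓞 K) * α0 ^ 134)| =
    |Algebra.norm ℤ (aeval θ (derivative (minpoly ℤ θ)))| * 3 ^ 404 := by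
  rw [abs_norm_Z α hα hgen α0 h0 θ h, norm_al α hα hgen α0 h0]
  have := discr_K α 45 (Or.inr rfl) hα hgen
  have h2 : |discr K| * 3 ^ (9 * 45 - 1) = (((3 * 45 : ℕ) : ℤ)) ^ (3 * 45) * 2214 ^ (3 * 45 - 1) := by
    exact_mod_cast this
  exact h2.symm

lemma case_k : ∃ (R : Type u) (_ : CommRing R) (_ : Algebra R (𝓞 K)) (_ : IsDomain R)
    (_ : IsIntegrallyClosed R) (_ : Module.IsTorsionFree R (𝓞 K)), IsIntegral R θ ∧
    Algebra.adjoin R {θ} = ⊤ ∧ (minpoly R θ).natDegree = 3 ∧ (∃ a : R, algebraMap R (𝓞 K) a = α0 ^ 3) ∧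
    |Algebra.norm ℤ (((3 : ℕ) : 𝓞 K) * α0 ^ 2)| =
    |Algebra.norm ℤ (aeval θ (derivative (minpoly R θ)))| * 9 := by
  have hK := finrank_eq α 135 (by norm_num) hα hgen
  let k := IntermediateField.adjoin ℚ {α ^ 3}
  let β : k := ⟨α ^ 3, IntermediateField.mem_adjoin_simple_self ℚ _⟩
  have hβ : β ^ 45 = -2214 := by
    apply Subtype.ext
    show (α ^ 3) ^ 45 = -2214
    rw [← pow_mul]; exact hα
  have hβgen : Algebra.adjoin ℚ {β} = ⊤ := by
    have hi : IsIntegral ℚ (α ^ 3) := Algebra.IsIntegral.isIntegral _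
    exact (IntermediateField.adjoin.powerBasis hi).adjoin_gen_eq_top
  have hk := finrank_eq β 45 (by norm_num) hβ hβgen
  have hkK : Module.finrank k K = 3 := by
    have := Module.finrank_mul_finrank ℚ k K
    rw [hk, hK] at this
    omega
  have htop : Algebra.adjoin (𝓞 k) {θ} = ⊤ := by
    rw [eq_top_iff]
    intro x _
    have hx : x ∈ Algebra.adjoin ℤ {θ} := by rw [h]; trivial
    rw [Algebra.adjoin_singleton_eq_range_aeval] at hx
    obtain ⟨p, hp⟩ := hx
    rw [← hp]
    show aeval θ p ∈ _
    rw [← aeval_map_algebraMap (𝓞 k)]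
    exact aeval_mem_adjoin_singleton _ _
  refine ⟨𝓞 k, inferInstance, inferInstance, inferInstance, inferInstance, inferInstance,
    Algebra.IsIntegral.isIntegral θ, htop, ?_, ?_, ?_⟩
  · rw [minpoly_deg (𝓞 k) k θ htop, hkK]
  · refine ⟨⟨β, isInt β 45 (by norm_num) hβ⟩, ?_⟩
    apply RingOfIntegers.coe_injective
    rw [map_pow, h0]
    rfl
  · rw [norm_al α hα hgen α0 h0]
    have e1 := diff_norm (𝓞 k) k θ htop
    have e2 := NumberField.natAbs_discr_eq_absNorm_differentIdeal_mul_natAbs_discr_pow k (𝓞 k) K (𝓞 K)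
    have e3 := discr_K α 45 (Or.inr rfl) hα hgen
    have e4 := discr_K β 15 (Or.inl rfl) hβ hβgen
    rw [hkK, e1] at e2
    have e5 := discr_ratio (|(Algebra.norm ℤ (aeval θ (derivative (minpoly (𝓞 k) θ))) : ℤ)| : ℤ)
      |(discr k : ℚ)| |(discr K : ℚ)| e4 e3 (by
        have := congrArg (Nat.cast (R := ℚ)) e2
        push_cast at this
        simpa [Nat.cast_natAbs] using this)
    exact_mod_cast e5

end

lemma apply_rel {K F : Type*} [Field K] [NumberField K] [Field F] [CharP F 41]
    (R : Type*) [CommRing R] [Algebra R (𝓞 K)] [IsDomain R]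
    [IsIntegrallyClosed R] [Module.IsTorsionFree R (𝓞 K)] (θ α0 : 𝓞 K) (hθ : IsIntegral R θ)
    (htop : Algebra.adjoin R {θ} = ⊤) (r : ℕ) (hr : 2 ≤ r) (hdeg : (minpoly R θ).natDegree = r)
    (a : R) (ha : algebraMap R (𝓞 K) a = α0 ^ r) (t : ℕ)
    (hN : |Algebra.norm ℤ ((r : 𝓞 K) * α0 ^ (r - 1))| =
      |Algebra.norm ℤ (aeval θ (derivative (minpoly R θ)))| * t)
    (ψ : 𝓞 K →+* F) (hψ : ψ α0 = 0) (hα0 : α0 ≠ 0) (g : ℤ[X]) (hg : aeval θ g = α0)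
    (hK : Module.finrank ℚ K = 135)
    (hnil : ∀ z : 𝓞 K, ∃ (n : ℤ) (w : 𝓞 K), (z - n) ^ 135 = 41 * w) :
    ψ (aeval θ (derivative (minpoly R θ))) = 0 ∧
    ((t : F) * ψ (aeval θ (derivative g)) ^ 135 = (ψ (aeval θ (derivative g)) ^ r) ^ 135 ∨
     (t : F) * ψ (aeval θ (derivative g)) ^ 135 = -(ψ (aeval θ (derivative g)) ^ r) ^ 135) := by
  have h41 : (41 : F) = 0 := by exact_mod_cast CharP.cast_eq_zero F 41
  obtain ⟨n, w, hw⟩ := hnil θ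
  obtain ⟨h1, S, hS, hS2⟩ := local_rel θ α0 hθ htop ψ (by rw [map_ofNat, h41]) n w hw r hr hdeg a ha hψ
    (g.map (algebraMap ℤ R)) (by rw [aeval_map_algebraMap, hg])
  rw [derivative_map, aeval_map_algebraMap] at hS hS2
  refine ⟨h1, ?_⟩
  have h2 := rel_norm _ _ _ _ hS t (by positivity) hN
    (mul_ne_zero (by exact_mod_cast (by omega : r ≠ 0)) (pow_ne_zero _ hα0))
  have hG : ((Algebra.norm ℤ (aeval θ (derivative g)) : ℤ) : F) = ψ (aeval θ (derivative g)) ^ 135 := by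
    obtain ⟨n, w, hw⟩ := hnil (aeval θ (derivative g))
    exact norm_psi ψ hK _ w n hw
  have hS3 : ((Algebra.norm ℤ S : ℤ) : F) = (ψ (aeval θ (derivative g)) ^ r) ^ 135 := by
    obtain ⟨n, w, hw⟩ := hnil S
    rw [norm_psi ψ hK _ w n hw, hS2]
  rw [← hS3, ← hG]
  rcases h2 with h2 | h2
  · left; exact_mod_cast congrArg (Int.cast (R := F)) h2
  · right; exact_mod_cast congrArg (Int.cast (R := F)) h2

theorem main {K : Type*} [Field K] [NumberField K] (α : K) (hα : α ^ 135 = -2214)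
    (hgen : Algebra.adjoin ℚ {α} = ⊤) (θ : 𝓞 K) (h : Algebra.adjoin ℤ {θ} = ⊤) : False := by
  have hK := finrank_eq α 135 (by norm_num) hα hgen
  obtain ⟨α0, h0⟩ : ∃ α0 : 𝓞 K, algebraMap (𝓞 K) K α0 = α :=
    ⟨⟨α, isInt α 135 (by norm_num) hα⟩, rfl⟩
  have hα0 : α0 ^ 135 = -2214 := by
    apply RingOfIntegers.coe_injective
    rw [map_pow, h0, hα, map_neg, map_ofNat]
  have hne : α0 ≠ 0 := by
    rintro rfl
    rw [zero_pow (by norm_num)] at hα0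
    norm_num at hα0
  have h3 : ∀ z : 𝓞 K, ∃ (k : ℕ) (p : ℤ[X]), 3 ^ k * z = aeval α0 p := by
    intro z
    obtain ⟨k, hk⟩ := three_pow α 27 (Or.inr rfl) hα hgen (z : K) (RingOfIntegers.isIntegral_coe z)
    rw [Algebra.adjoin_singleton_eq_range_aeval] at hk
    obtain ⟨p, hp⟩ := hk
    refine ⟨k, p, ?_⟩
    apply RingOfIntegers.coe_injective
    rw [← aeval_algebraMap_apply, h0, map_mul, map_pow, map_ofNat]
    exact hp.symm
  have hnil := nil41 α0 hα0 h3
  obtain ⟨P, hP, h41⟩ := ex_psi (K := K)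
  let _ := Ideal.Quotient.field P
  let ψ := Ideal.Quotient.mk P
  have h41' : (41 : 𝓞 K ⧸ P) = 0 := by
    have : ψ 41 = 0 := Ideal.Quotient.eq_zero_iff_mem.mpr h41
    rwa [map_ofNat] at this
  have : CharP (𝓞 K ⧸ P) 41 := by
    exact (CharP.charP_iff_prime_eq_zero (by norm_num)).mpr (by exact_mod_cast h41')
  have hψ : ψ α0 = 0 := by
    have := congrArg ψ hα0
    rw [map_pow, map_neg, map_ofNat] at this
    have h2 : -(2214 : 𝓞 K ⧸ P) = 0 := by linear_combination -54 * h41'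
    rw [h2] at this
    exact (pow_eq_zero_iff (by norm_num)).mp this
  obtain ⟨g, hg⟩ : ∃ g : ℤ[X], aeval θ g = α0 := by
    have hx : α0 ∈ Algebra.adjoin ℤ {θ} := by rw [h]; trivial
    rw [Algebra.adjoin_singleton_eq_range_aeval] at hx
    exact hx
  have hZ := apply_rel ℤ θ α0 (RingOfIntegers.isIntegral θ) h 135 (by norm_num)
    (by rw [minpoly_deg ℤ ℚ θ h, hK]) (-2214) (by rw [hα0]; simp) (3 ^ 404)
    (by rw [case_Z α hα hgen α0 h0 θ h]; push_cast; rfl) ψ hψ hne g hg hK hnil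
  obtain ⟨R, _, _, _, _, _, i1, i2, i3, ⟨a, i4⟩, i5⟩ := case_k α hα hgen α0 h0 θ h
  have hk := apply_rel R θ α0 i1 i2 3 (by norm_num) i3 a i4 9
    (by rw [i5]; rfl) ψ hψ hne g hg hK hnil
  obtain ⟨k, p, hp⟩ := h3 θ
  have hc := c_ne ψ θ α0 g p k hg hp hZ.1
  refine final_F _ hc ?_ ?_
  · have := hZ.2
    push_cast at this
    exact this
  · have := hk.2
    push_cast at this
    exact this

end Ex16

/-- The polynomial `f(x) = x^135 + C 2214` is irreducible over `ℚ`, and the pure number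
field `K = ℚ(α)`, where `α` is a complex root of `f`, is not monogenic. -/
theorem example_16
    {K : Type*} [Field K] [NumberField K]
    (α : K)
    (hroot : Polynomial.aeval α ((X : ℤ[X]) ^ 135 + C 2214) = 0)
    (hgen : Algebra.adjoin ℚ {α} = ⊤) :
    Irreducible (((X : ℤ[X]) ^ 135 + C 2214).map (Int.castRingHom ℚ)) ∧
      ¬ ∃ θ : NumberField.RingOfIntegers K, Algebra.adjoin ℤ {θ} = ⊤ := by
  refine ⟨Ex16.irrQ 135 (by norm_num), ?_⟩
  rintro ⟨θ, h⟩
  refine Ex16.main α ?_ hgen θ h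
  have h1 : α ^ 135 + 2214 = 0 := by
    rw [map_add, map_pow, aeval_X, aeval_C] at hroot
    simpa using hroot
  exact eq_neg_of_add_eq_zero_left h1
end
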